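/- arXiv:2203.01096 — 4 statements merged into one kernel-verified Lean document; each statement's English description precedes it below -/
import Mathlib

section
/- Let N = ((V ∪ {s}, A), τ) be an acyclic pre-flow temporal network and let k ∈ ℕ. Then there exists a packing of k τ-respecting s-arborescences such that each vertex v ∈ V belongs to at least min{k, λ_N(s,v)} of them. -/
/-- A directed graph (possibly with parallel arcs): arc type `At`, vertex type `Vt`,
each arc has a tail and a head. -/
structure Dgraph (Vt At : Type) where
  tail : At → Vt
  head : At → Vt

namespace Dgraph

variable {Vt At : Type}

/-- `D.WalkFrom u p v` : the list of arcs `p` forms a directed walk from `u` to `v`. -/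
def WalkFrom (D : Dgraph Vt At) : Vt → List At → Vt → Prop
  | u, [], v => u = v
  | u, a :: p, v => D.tail a = u ∧ D.WalkFrom (D.head a) p v

/-- The vertices visited by a walk starting at `u` with arc list `p`. -/
def walkVerts (D : Dgraph Vt At) (u : Vt) (p : List At) : List Vt :=
  u :: p.map D.head

/-- A directed path from `u` to `v`: a walk visiting pairwise distinct vertices. -/
def IsPath (D : Dgraph Vt At) (u : Vt) (p : List At) (v : Vt) : Prop :=
  D.WalkFrom u p v ∧ (D.walkVerts u p).Nodup

/-- An arc list is τ-respecting if its τ-values are non-decreasing. -/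
def Respects (τ : At → ℕ) (p : List At) : Prop :=
  List.Chain' (· ≤ ·) (p.map τ)

/-- An arc list is monochromatic w.r.t. a colouring `c` if all its arcs get the same colour. -/
def Monochromatic (c : At → Bool) (p : List At) : Prop :=
  ∀ a ∈ p, ∀ b ∈ p, c a = c b

/-- There is no directed cycle using only arcs of `B`
(equivalently, no nonempty closed directed walk inside `B`). -/
def AcyclicOn (D : Dgraph Vt At) (B : Set At) : Prop :=
  ¬ ∃ (v : Vt) (p : List At), p ≠ [] ∧ (∀ a ∈ p, a ∈ B) ∧ D.WalkFrom v p v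

/-- The directed graph contains no directed cycle. -/
def Acyclic (D : Dgraph Vt At) : Prop :=
  D.AcyclicOn Set.univ

/-- `u` reaches `v` by a directed walk. -/
def Reaches (D : Dgraph Vt At) (u v : Vt) : Prop :=
  ∃ p : List At, D.WalkFrom u p v

/-- `u` and `v` are in the same strongly connected component. -/
def MutuallyReachable (D : Dgraph Vt At) (u v : Vt) : Prop :=
  D.Reaches u v ∧ D.Reaches v u

/-- A temporal network `(D, τ)` is consistent if any two arcs lying in the same strongly
connected component (i.e. whose endpoints are all mutually reachable) have the same τ-value. -/
def Consistent (D : Dgraph Vt At) (τ : At → ℕ) : Prop :=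
  ∀ a b : At,
    D.MutuallyReachable (D.tail a) (D.head a) →
    D.MutuallyReachable (D.tail b) (D.head b) →
    D.MutuallyReachable (D.tail a) (D.tail b) →
    τ a = τ b

section Fin

variable [DecidableEq Vt] [Fintype At]

/-- The vertex set of the subgraph with arc set `B`, together with the root `s`. -/
def vertsF (D : Dgraph Vt At) (s : Vt) (B : Finset At) : Finset Vt :=
  insert s (B.image D.tail ∪ B.image D.head)

/-- In-degree of `v` in the subgraph with arc set `B`. -/
def indegOn (D : Dgraph Vt At) (B : Finset At) (v : Vt) : ℕ :=
  (B.filter (fun a => D.head a = v)).card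

/-- In-degree of `v`. -/
def indeg (D : Dgraph Vt At) (v : Vt) : ℕ :=
  D.indegOn Finset.univ v

/-- Out-degree of `v`. -/
def outdeg (D : Dgraph Vt At) (v : Vt) : ℕ :=
  (Finset.univ.filter (fun a => D.tail a = v)).card

/-- `ρ^i_N(v)` : the set of arcs entering `v` with τ-value at most `i`. -/
def rhoLe (D : Dgraph Vt At) (τ : At → ℕ) (v : Vt) (i : ℕ) : Finset At :=
  Finset.univ.filter (fun a => D.head a = v ∧ τ a ≤ i)

/-- `δ^i_N(v)` : the set of arcs leaving `v` with τ-value at most `i`. -/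
def deltaLe (D : Dgraph Vt At) (τ : At → ℕ) (v : Vt) (i : ℕ) : Finset At :=
  Finset.univ.filter (fun a => D.tail a = v ∧ τ a ≤ i)

/-- The temporal network `(D, τ)` with root `s` is pre-flow:
`|ρ^i_N(v)| ≥ |δ^i_N(v)|` for every `i` and every non-root vertex `v`. -/
def Preflow (D : Dgraph Vt At) (τ : At → ℕ) (s : Vt) : Prop :=
  ∀ (i : ℕ) (v : Vt), v ≠ s → (D.deltaLe τ v i).card ≤ (D.rhoLe τ v i).card

/-- The arc set `B` induces an `s`-arborescence: the subgraph contains `s`,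
has no directed cycle, and every vertex of it other than `s` has in-degree exactly 1. -/
def IsArb (D : Dgraph Vt At) (s : Vt) (B : Finset At) : Prop :=
  D.AcyclicOn (↑B) ∧ ∀ v ∈ D.vertsF s B, v ≠ s → D.indegOn B v = 1

/-- The arc set `B` induces a τ-respecting `s`-arborescence: an `s`-arborescence in which,
for every vertex `v` of the arborescence, the (unique) path from `s` to `v` is τ-respecting. -/
def IsTArb (D : Dgraph Vt At) (τ : At → ℕ) (s : Vt) (B : Finset At) : Prop :=
  D.IsArb s B ∧
    ∀ v ∈ D.vertsF s B, ∀ p : List At, (∀ a ∈ p, a ∈ B) → D.IsPath s p v → Respects τ p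

/-- There exist `k` pairwise arc-disjoint τ-respecting directed paths from `s` to `v`. -/
def HasTPaths (D : Dgraph Vt At) (τ : At → ℕ) (s v : Vt) (k : ℕ) : Prop :=
  ∃ P : Fin k → List At,
    (∀ i, D.IsPath s (P i) v ∧ Respects τ (P i)) ∧
    ∀ i j, i ≠ j → ∀ a, a ∈ P i → a ∉ P j

/-- `λ_N(s,v)` : the maximum number of pairwise arc-disjoint τ-respecting `(s,v)`-paths. -/
noncomputable def lambdaT (D : Dgraph Vt At) (τ : At → ℕ) (s v : Vt) : ℕ :=
  sSup {k | D.HasTPaths τ s v k}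

/-- `λ_D(s,v)` : the maximum number of pairwise arc-disjoint `(s,v)`-paths. -/
noncomputable def lambda (D : Dgraph Vt At) (s v : Vt) : ℕ :=
  D.lambdaT (fun _ => 0) s v

end Fin

end Dgraph

namespace Dgraph

variable {Vt At : Type}

/-- In a finite acyclic digraph, the relation "`b` can follow `a` in a walk" is well-founded. -/
theorem Acyclic.wellFounded_follows [Finite At] {D : Dgraph Vt At} (hD : D.Acyclic) :
    WellFounded (fun b a : At => D.tail b = D.head a) := by
  have walk : ∀ b a : At, Relation.TransGen (fun b a : At => D.tail b = D.head a) b a →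
      ∃ p : List At, p ≠ [] ∧ D.WalkFrom (D.head a) p (D.head b) := by
    intro b a h
    induction h with
    | single h => exact ⟨[b], by simp, h, rfl⟩
    | @tail x y _ h ih =>
      obtain ⟨p, -, hp⟩ := ih
      exact ⟨x :: p, by simp, h, hp⟩
  have : Std.Irrefl (Relation.TransGen (fun b a : At => D.tail b = D.head a)) :=
    ⟨fun a h => by
      obtain ⟨p, hp, hw⟩ := walk a a h
      exact hD ⟨D.head a, p, hp, fun _ _ => Set.mem_univ _, hw⟩⟩
  have wf : WellFounded (Relation.TransGen (fun b a : At => D.tail b = D.head a)) :=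
    Finite.wellFounded_of_trans_of_irrefl _
  exact wf.mono fun _ _ h => Relation.TransGen.single h

/-- A walk between distinct vertices uses an arc entering its end vertex. -/
theorem WalkFrom.exists_mem_head_eq {D : Dgraph Vt At} :
    ∀ {p : List At} {u v : Vt}, D.WalkFrom u p v → u ≠ v → ∃ a ∈ p, D.head a = v
  | [], _, _, h, hne => absurd h hne
  | a :: p, _, v, h, _ => by
    by_cases hav : D.head a = v
    · exact ⟨a, by simp, hav⟩
    · obtain ⟨b, hb, hbv⟩ := WalkFrom.exists_mem_head_eq h.2 hav
      exact ⟨b, by simp [hb], hbv⟩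

/-- A walk is τ-respecting as soon as all its pairs of consecutive arcs are. -/
theorem WalkFrom.respects {D : Dgraph Vt At} {τ : At → ℕ} {B : Set At}
    (hB : ∀ a ∈ B, ∀ b ∈ B, D.tail b = D.head a → τ a ≤ τ b) :
    ∀ {p : List At} {u v : Vt}, D.WalkFrom u p v → (∀ a ∈ p, a ∈ B) → Respects τ p
  | [], _, _, _, _ => List.isChain_nil
  | [_], _, _, _, _ => List.isChain_singleton _
  | a :: b :: p, _, _, h, hp => by
    have ih := WalkFrom.respects hB h.2 (fun x hx => hp x (List.mem_cons_of_mem _ hx))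
    have hab := hB a (hp a (by simp)) b (hp b (by simp)) h.2.1
    simp only [Respects, List.map_cons] at ih ⊢
    exact List.isChain_cons_cons.2 ⟨hab, ih⟩

section Fin

variable [DecidableEq Vt] [Fintype At]

theorem lambdaT_le_indeg (D : Dgraph Vt At) (τ : At → ℕ) {s v : Vt} (hv : v ≠ s) :
    D.lambdaT τ s v ≤ D.indeg v := by
  refine csSup_le' ?_
  rintro m ⟨P, hP, hdisj⟩
  choose e heP hev using fun i => (hP i).1.1.exists_mem_head_eq hv.symm
  have hinj : Function.Injective e := by
    intro i j hij
    by_contra hne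
    exact hdisj i j hne (e i) (heP i) (hij ▸ heP j)
  calc m = (Finset.univ.map ⟨e, hinj⟩).card := by simp
    _ ≤ D.indeg v := Finset.card_le_card fun a ha => by
      obtain ⟨i, -, rfl⟩ := Finset.mem_map.1 ha
      simp [hev]

/-- In a pre-flow network the arcs leaving a non-root vertex can be matched injectively
to entering arcs that are not later. -/
theorem Preflow.exists_matching [DecidableEq At] {D : Dgraph Vt At} {τ : At → ℕ} {s : Vt}
    (hpre : D.Preflow τ s) {v : Vt} (hv : v ≠ s) :
    ∃ φ : {b : At // D.tail b = v} → At, Function.Injective φ ∧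
      ∀ b, D.head (φ b) = v ∧ τ (φ b) ≤ τ b := by
  obtain ⟨φ, hinj, hφ⟩ := (Finset.all_card_le_biUnion_card_iff_exists_injective
    (fun b : {b : At // D.tail b = v} => D.rhoLe τ v (τ b))).1 (by
      intro X
      rcases X.eq_empty_or_nonempty with rfl | hX
      · simp
      obtain ⟨m, hmX, hm⟩ := X.exists_max_image (fun b => τ b) hX
      calc X.card = (X.map (Function.Embedding.subtype _)).card := (Finset.card_map _).symm
        _ ≤ (D.deltaLe τ v (τ m)).card := Finset.card_le_card fun a ha => by
          obtain ⟨b, hb, rfl⟩ := Finset.mem_map.1 ha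
          simpa [deltaLe, b.2] using hm b hb
        _ ≤ (D.rhoLe τ v (τ m)).card := hpre _ _ hv
        _ ≤ _ := Finset.card_le_card
          (Finset.subset_biUnion_of_mem (fun b : {b : At // D.tail b = v} => D.rhoLe τ v (τ b))
            hmX))
  exact ⟨φ, hinj, fun b => by simpa [rhoLe] using hφ b⟩

/-- `f` colours the arcs entering `v` properly, compatibly with the colouring `g` of the arcs
leaving `v`, and with as many of the `k` colours as possible. -/
structure GoodAt (D : Dgraph Vt At) (τ : At → ℕ) (k : ℕ) (v : Vt)
    (g f : At → Option (Fin k)) : Prop where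
  unique : ∀ a b i, D.head a = v → D.head b = v → f a = some i → f b = some i → a = b
  feeds : ∀ b i, D.tail b = v → g b = some i → ∃ a, D.head a = v ∧ f a = some i ∧ τ a ≤ τ b
  many : ∃ J : Finset (Fin k), min k (D.indeg v) ≤ J.card ∧
    ∀ i ∈ J, ∃ a, D.head a = v ∧ f a = some i

theorem Preflow.exists_goodAt [DecidableEq At] {D : Dgraph Vt At} {τ : At → ℕ} {s : Vt}
    (hpre : D.Preflow τ s) (k : ℕ) {v : Vt} (hv : v ≠ s) (g : At → Option (Fin k)) :
    ∃ f, D.GoodAt τ k v g f := by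
  classical
  obtain ⟨φ, hφinj, hφ⟩ := hpre.exists_matching hv
  let I : Finset (Fin k) := Finset.univ.filter fun i => ∃ b, D.tail b = v ∧ g b = some i
  have hmin : ∀ i ∈ I, ∃ a, (∃ b, g b.1 = some i ∧ φ b = a) ∧ D.head a = v ∧
      ∀ b', D.tail b' = v → g b' = some i → τ a ≤ τ b' := by
    intro i hi
    obtain ⟨b₀, hb₀, hg₀⟩ := (Finset.mem_filter.1 hi).2
    obtain ⟨m, hm, hle⟩ :=
      (Finset.univ.filter fun b => D.tail b = v ∧ g b = some i).exists_min_image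
        τ ⟨b₀, by simp [hb₀, hg₀]⟩
    simp only [Finset.mem_filter, Finset.mem_univ, true_and] at hm hle
    exact ⟨φ ⟨m, hm.1⟩, ⟨⟨m, hm.1⟩, hm.2, rfl⟩, (hφ _).1,
      fun b' h1 h2 => (hφ _).2.trans (hle b' ⟨h1, h2⟩)⟩
  rcases isEmpty_or_nonempty At with hAt | hAt
  · exact ⟨g, fun a => isEmptyElim a, fun b => isEmptyElim b,
      ∅, by simp [indeg, indegOn], by simp⟩
  choose! ψ hψb hψv hψle using hmin
  have hψinj : Set.InjOn ψ I := by
    intro i hi j hj hij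
    obtain ⟨b, hb, hba⟩ := hψb i hi
    obtain ⟨b', hb', hba'⟩ := hψb j hj
    obtain rfl : b = b' := hφinj (by rw [hba, hba', hij])
    exact Option.some_injective _ (hb.symm.trans hb')
  let E : Finset At := Finset.univ.filter fun a => D.head a = v
  have hψE : I.image ψ ⊆ E := fun a ha => by
    obtain ⟨i, hi, rfl⟩ := Finset.mem_image.1 ha
    simp [E, hψv i hi]
  have hcard : (I.image ψ).card = I.card := Finset.card_image_of_injOn hψinj
  have hIk : I.card ≤ k := by simpa using I.card_le_univ
  have hIE : I.card ≤ E.card := hcard ▸ Finset.card_le_card hψE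
  obtain ⟨J, hIJ, -, hJ⟩ := Finset.exists_subsuperset_card_eq (Finset.subset_univ I)
    (le_min hIk hIE) (by simp)
  obtain ⟨T, hIT, hTE, hT⟩ := Finset.exists_subsuperset_card_eq hψE
    (hcard.le.trans (le_min hIk hIE)) (min_le_right _ _)
  obtain ⟨ε, hε⟩ := Finset.exists_equiv_extend_of_card_eq (α := J) (t := T) (by simp [hJ, hT])
    (s := Finset.univ.filter fun i : J => i.1 ∈ I) (f := fun i => ψ i)
    (fun a ha => by
      obtain ⟨i, hi, rfl⟩ := Finset.mem_image.1 ha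
      exact hIT (Finset.mem_image_of_mem ψ (Finset.mem_filter.1 hi).2))
    (fun i hi j hj hij => Subtype.ext
      (hψinj (Finset.mem_filter.1 hi).2 (Finset.mem_filter.1 hj).2 hij))
  have hεv : ∀ i, D.head (ε i).1 = v := fun i => (Finset.mem_filter.1 (hTE (ε i).2)).2
  let f : At → Option (Fin k) := fun a => if h : a ∈ T then some (ε.symm ⟨a, h⟩).1 else none
  have hfε : ∀ i, f (ε i) = some i.1 := fun i => by simp [f]
  have hf : ∀ a i, f a = some i → ∃ j : J, j.1 = i ∧ (ε j).1 = a := by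
    intro a i h
    by_cases ha : a ∈ T
    · exact ⟨ε.symm ⟨a, ha⟩, by simpa [f, ha] using h, by simp⟩
    · simp [f, ha] at h
  refine ⟨f, ?_, ?_, J, hJ.ge, fun i hi => ⟨ε ⟨i, hi⟩, hεv _, hfε _⟩⟩
  · intro a b i _ _ ha hb
    obtain ⟨j, hj, rfl⟩ := hf a i ha
    obtain ⟨j', hj', rfl⟩ := hf b i hb
    rw [Subtype.ext (hj.trans hj'.symm)]
  · intro b i hb hg
    have hi : i ∈ I := Finset.mem_filter.2 ⟨Finset.mem_univ _, b, hb, hg⟩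
    refine ⟨ε ⟨i, hIJ hi⟩, hεv _, hfε _, ?_⟩
    rw [hε ⟨i, hIJ hi⟩ (by simpa using hi)]
    exact hψle i hi b hb hg

theorem GoodAt.congr {D : Dgraph Vt At} {τ : At → ℕ} {k : ℕ} {v : Vt}
    {g g' f f' : At → Option (Fin k)} (h : D.GoodAt τ k v g f)
    (hg : ∀ b, D.tail b = v → g' b = g b) (hf : ∀ a, D.head a = v → f' a = f a) :
    D.GoodAt τ k v g' f' where
  unique a b i ha hb hfa hfb := h.unique a b i ha hb (hf a ha ▸ hfa) (hf b hb ▸ hfb)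
  feeds b i hb hgb := by
    obtain ⟨a, ha, hfa, hle⟩ := h.feeds b i hb (hg b hb ▸ hgb)
    exact ⟨a, ha, (hf a ha).trans hfa, hle⟩
  many := by
    obtain ⟨J, hJ, hJa⟩ := h.many
    refine ⟨J, hJ, fun i hi => ?_⟩
    obtain ⟨a, ha, hfa⟩ := hJa i hi
    exact ⟨a, ha, (hf a ha).trans hfa⟩

/-- An acyclic pre-flow network has an arc colouring that is good at all non-root vertices:
the arcs entering a vertex are coloured after all the arcs leaving it. -/
theorem Preflow.exists_colouring [DecidableEq At] {D : Dgraph Vt At} {τ : At → ℕ} {s : Vt}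
    (hpre : D.Preflow τ s) (hroot : ∀ a : At, D.head a ≠ s) (hacyc : D.Acyclic) (k : ℕ) :
    ∃ c : At → Option (Fin k), ∀ v, v ≠ s → D.GoodAt τ k v c c := by
  classical
  choose F hF using fun (v : {v : Vt // v ≠ s}) => hpre.exists_goodAt k v.2
  let step : ∀ a : At, (∀ b, D.tail b = D.head a → Option (Fin k)) → Option (Fin k) :=
    fun a col => F ⟨D.head a, hroot a⟩
      (fun b => if h : D.tail b = D.head a then col b h else none) a
  let c : At → Option (Fin k) := hacyc.wellFounded_follows.fix step
  have hc : ∀ a, c a = F ⟨D.head a, hroot a⟩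
      (fun b => if D.tail b = D.head a then c b else none) a := fun a => by
    have := hacyc.wellFounded_follows.fix_eq step a
    simpa [step, c] using this
  refine ⟨c, fun v hv => (hF ⟨v, hv⟩ fun b => if D.tail b = v then c b else none).congr
    (fun b hb => by simp [hb]) ?_⟩
  rintro a rfl
  exact hc a

end Fin

end Dgraph


/-- In an acyclic pre-flow temporal network `N = ((V ∪ {s}, A), τ)`, for any
`k ∈ ℕ` there is a packing of `k` τ-respecting `s`-arborescences such that each vertex
`v ∈ V` belongs to at least `min {k, λ_N(s,v)}` of them. -/
theorem packing_acyclic_preflow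
    {Vt At : Type} [Fintype Vt] [DecidableEq Vt] [Fintype At] [DecidableEq At]
    (D : Dgraph Vt At) (τ : At → ℕ) (s : Vt)
    (hroot : ∀ a : At, D.head a ≠ s)
    (hacyc : D.Acyclic)
    (hpre : D.Preflow τ s)
    (k : ℕ) :
    ∃ B : Fin k → Finset At,
      (∀ i, D.IsTArb τ s (B i)) ∧
      (∀ i j, i ≠ j → Disjoint (B i) (B j)) ∧
      ∀ v : Vt, v ≠ s →
        min k (D.lambdaT τ s v) ≤
          (Finset.univ.filter (fun i => v ∈ D.vertsF s (B i))).card := by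
  obtain ⟨c, hc⟩ := hpre.exists_colouring hroot hacyc k
  have hne : ∀ {a b : At}, D.tail b = D.head a → D.tail b ≠ s := fun {a _} h => h ▸ hroot a
  refine ⟨fun i => Finset.univ.filter fun a => c a = some i, fun i => ⟨⟨?_, ?_⟩, ?_⟩, ?_, ?_⟩
  · rintro ⟨v, p, hp, -, hw⟩
    exact hacyc ⟨v, p, hp, fun _ _ => Set.mem_univ _, hw⟩
  · intro v hv hvs
    have hex : ∃ a, D.head a = v ∧ c a = some i := by
      simp only [Dgraph.vertsF, Finset.mem_insert, Finset.mem_union, Finset.mem_image,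
        Finset.mem_filter, Finset.mem_univ, true_and] at hv
      rcases hv with hv | ⟨b, hb, hbv⟩ | ⟨a, ha, hav⟩
      · exact absurd hv hvs
      · obtain ⟨a, hav, ha, -⟩ := (hc v hvs).feeds b i hbv hb
        exact ⟨a, hav, ha⟩
      · exact ⟨a, hav, ha⟩
    obtain ⟨a, hav, ha⟩ := hex
    refine Finset.card_eq_one.2 ⟨a, ?_⟩
    ext b
    simp only [Finset.mem_filter, Finset.mem_univ, true_and, Finset.mem_singleton]
    refine ⟨fun hb => (hc v hvs).unique b a i hb.2 hav hb.1 ha, ?_⟩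
    rintro rfl
    exact ⟨ha, hav⟩
  · intro v _ p hp hpath
    refine hpath.1.respects (B := {a | c a = some i}) ?_ fun a ha => by simpa using hp a ha
    intro a ha b hb hab
    obtain ⟨a', ha'v, ha', hle⟩ := (hc _ (hne hab)).feeds b i rfl hb
    rwa [(hc _ (hne hab)).unique a a' i hab.symm ha'v ha ha']
  · intro i j hij
    refine Finset.disjoint_left.2 fun a ha hb => hij ?_
    simp only [Finset.mem_filter, Finset.mem_univ, true_and] at ha hb
    exact Option.some_injective _ (ha.symm.trans hb)
  · intro v hv
    obtain ⟨J, hJ, hJa⟩ := (hc v hv).many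
    refine (min_le_min_left k (D.lambdaT_le_indeg τ hv)).trans
      (hJ.trans (Finset.card_le_card fun i hi => ?_))
    obtain ⟨a, hav, ha⟩ := hJa i hi
    refine Finset.mem_filter.2 ⟨Finset.mem_univ _, ?_⟩
    simp only [Dgraph.vertsF, Finset.mem_insert, Finset.mem_union, Finset.mem_image,
      Finset.mem_filter, Finset.mem_univ, true_and]
    exact Or.inr (Or.inr ⟨a, ha, hav⟩)
end

section
/- Let N = ((V ∪ {s}, A), τ) be an acyclic temporal network and let k ∈ ℕ be such that min{k, |ρ^i_N(v)|} ≥ min{k, |δ^i_N(v)|} for all i ∈ ℕ and all v ∈ V. Then there exists a packing of k τ-respecting s-arborescences such that each vertex v ∈ V belongs to exactly min{k, d^-_D(v)} of them. -/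
namespace Dgraph

variable {Vt At : Type}

/-- In a finite acyclic digraph the out-neighbour relation is well founded. -/
theorem Acyclic.wellFounded [Finite Vt] {D : Dgraph Vt At} (h : D.Acyclic) :
    WellFounded (fun w v : Vt => ∃ a, D.tail a = v ∧ D.head a = w) := by
  set R : Vt → Vt → Prop := fun w v => ∃ a, D.tail a = v ∧ D.head a = w
  have walk : ∀ w v, Relation.TransGen R w v → ∃ p, p ≠ [] ∧ D.WalkFrom v p w := by
    intro w v hwv
    induction hwv with
    | single hab =>
      obtain ⟨a, rfl, rfl⟩ := hab
      exact ⟨[a], by simp, rfl, rfl⟩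
    | tail _ hbc ih =>
      obtain ⟨a, rfl, rfl⟩ := hbc
      obtain ⟨p, -, hp⟩ := ih
      exact ⟨a :: p, by simp, rfl, hp⟩
  have : Std.Irrefl (Relation.TransGen R) := ⟨fun v hv => by
    obtain ⟨p, hp, hw⟩ := walk v v hv
    exact h ⟨v, p, hp, fun _ _ => Set.mem_univ _, hw⟩⟩
  exact Subrelation.wf (fun hab => Relation.TransGen.single hab)
    (Finite.wellFounded_of_trans_of_irrefl (Relation.TransGen R))

/-- A finite type can be enumerated in non-decreasing order of a weight function. -/
theorem exists_monotone_equiv {α β : Type} [Fintype α] [LinearOrder β] (f : α → β) :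
    ∃ e : Fin (Fintype.card α) ≃ α, Monotone (f ∘ e) := by
  let e₀ := (Fintype.equivFin α).symm
  exact ⟨(Tuple.sort (f ∘ e₀)).trans e₀, Tuple.monotone_sort (f ∘ e₀)⟩

/-- If more than `l` terms of a monotone sequence are at most `b`, so is the term at index `l`. -/
theorem le_of_lt_card_filter_le {n : ℕ} {β : Type} [LinearOrder β] {f : Fin n → β}
    (hf : Monotone f) {b : β} {l : ℕ}
    (hl : l < (Finset.univ.filter (fun j => f j ≤ b)).card) :
    ∃ h : l < n, f ⟨l, h⟩ ≤ b := by
  have hn : l < n := hl.trans_le ((Finset.card_le_univ _).trans_eq (Fintype.card_fin n))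
  refine ⟨hn, ?_⟩
  by_contra hb
  have hsub : Finset.univ.filter (fun j => f j ≤ b) ⊆ Finset.Iio (⟨l, hn⟩ : Fin n) := by
    intro j hj
    rw [Finset.mem_Iio]
    by_contra hlt
    exact hb ((hf (not_lt.mp hlt)).trans (Finset.mem_filter.mp hj).2)
  have := Finset.card_le_card hsub
  rw [Fin.card_Iio] at this
  exact absurd hl (not_lt.mpr this)

variable [DecidableEq Vt] [Fintype At]

/-- Given any partial colouring of the arcs leaving `v`, colour the arcs entering `v` injectively
so that every coloured leaving arc is preceded by an entering arc of its colour. -/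
theorem exists_coloring_at (D : Dgraph Vt At) (τ : At → ℕ) (k : ℕ) (v : Vt)
    (hcond : ∀ i, min k (D.deltaLe τ v i).card ≤ min k (D.rhoLe τ v i).card)
    (c : At → Option (Fin k)) :
    ∃ g : At → Option (Fin k),
      (∀ e e' i, D.head e = v → D.head e' = v → g e = some i → g e' = some i → e = e') ∧
      (∀ f i, D.tail f = v → c f = some i →
        ∃ e, D.head e = v ∧ τ e ≤ τ f ∧ g e = some i) ∧
      {i | ∃ e, D.head e = v ∧ g e = some i}.ncard = min k (D.indeg v) := by
  classical
  let t : Fin k → ℕ∞ := fun i =>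
    (Finset.univ.filter (fun f => D.tail f = v ∧ c f = some i)).inf (fun f => (τ f : ℕ∞))
  let σ := Tuple.sort t
  have hσ : Monotone (t ∘ σ) := Tuple.monotone_sort t
  obtain ⟨en, hen⟩ := exists_monotone_equiv (fun e : {e : At // D.head e = v} => τ e)
  have hd : Fintype.card {e : At // D.head e = v} = D.indeg v := Fintype.card_subtype _
  let g : At → Option (Fin k) := fun e =>
    if h : D.head e = v then
      if hr : (en.symm ⟨e, h⟩).val < k then some (σ ⟨_, hr⟩) else none
    else none
  have hg : ∀ e i, g e = some i ↔
      ∃ h : D.head e = v, ((en.symm ⟨e, h⟩).val = (σ.symm i).val) := by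
    intro e i
    by_cases h : D.head e = v
    · by_cases hr : (en.symm ⟨e, h⟩).val < k
      · simp only [g, h, hr, dif_pos, Option.some.injEq, exists_true_left]
        rw [← Equiv.eq_symm_apply, Fin.ext_iff]
      · have := (σ.symm i).isLt
        simp only [g, h, hr, dif_pos, dif_neg, not_false_eq_true, exists_true_left]
        constructor
        · intro h'; cases h'
        · intro h'; omega
    · simp [g, h]
  refine ⟨g, ?_, ?_, ?_⟩
  · intro e e' i _ _ h1 h2
    obtain ⟨h, h1⟩ := (hg _ _).1 h1
    obtain ⟨h', h2⟩ := (hg _ _).1 h2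
    have := en.symm.injective (Fin.ext (h1.trans h2.symm))
    exact congrArg Subtype.val this
  · intro f i hf hc
    set l := σ.symm i with hl
    have hout : l.val < (D.deltaLe τ v (τ f)).card := by
      have hex : ∀ j : Fin k, j ≤ l → ∃ a, D.tail a = v ∧ τ a ≤ τ f ∧ c a = some (σ j) := by
        intro j hj
        have h1 : t (σ j) ≤ t i := by simpa [hl] using hσ hj
        have h2 : t i ≤ τ f := Finset.inf_le (by simp [hf, hc])
        have h3 : t (σ j) < ((τ f + 1 : ℕ) : ℕ∞) :=
          (h1.trans h2).trans_lt (by exact_mod_cast Nat.lt_succ_self _)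
        rw [Finset.inf_lt_iff] at h3
        obtain ⟨a, ha, hlt⟩ := h3
        rw [Finset.mem_filter] at ha
        exact ⟨a, ha.2.1, Nat.lt_succ_iff.mp (by exact_mod_cast hlt), ha.2.2⟩
      have : Nonempty At := ⟨f⟩
      choose! a ha using hex
      have := Finset.card_le_card_of_injOn (s := Finset.Iic l) (t := D.deltaLe τ v (τ f)) a
        (fun j hj => by
          have := ha j (by simpa using hj)
          simp [deltaLe, this.1, this.2.1])
        (fun j hj j' hj' hjj => by
          have h1 := (ha j (by simpa using hj)).2.2
          have h2 := (ha j' (by simpa using hj')).2.2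
          rw [hjj, h2] at h1
          exact (σ.injective (Option.some.inj h1)).symm)
      rw [Fin.card_Iic] at this
      omega
    have hin : l.val < (D.rhoLe τ v (τ f)).card := by
      have := hcond (τ f)
      have := l.isLt
      omega
    have hcard : (D.rhoLe τ v (τ f)).card =
        (Finset.univ.filter
          (fun j => ((fun e : {e : At // D.head e = v} => τ e) ∘ en) j ≤ τ f)).card := by
      symm
      refine Finset.card_bij (fun j _ => (en j).val) ?_ ?_ ?_
      · intro j hj
        simpa [rhoLe, (en j).2] using hj
      · intro j _ j' _ h
        exact en.injective (Subtype.ext h)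
      · intro e he
        simp only [rhoLe, Finset.mem_filter, Finset.mem_univ, true_and] at he
        exact ⟨en.symm ⟨e, he.1⟩, by simpa using he.2, by simp⟩
    rw [hcard] at hin
    obtain ⟨hlt, hle⟩ := le_of_lt_card_filter_le hen hin
    exact ⟨(en ⟨l, hlt⟩).val, (en ⟨l, hlt⟩).2, hle, (hg _ _).2 ⟨(en ⟨l, hlt⟩).2, by simp [hl]⟩⟩
  · have hset : {i | ∃ e, D.head e = v ∧ g e = some i} =
        σ '' {l : Fin k | l.val < D.indeg v} := by
      ext i
      simp only [Set.mem_ofPred_eq, Set.mem_image_equiv]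
      constructor
      · rintro ⟨e, _, he⟩
        obtain ⟨h, he⟩ := (hg _ _).1 he
        rw [← he, ← hd]
        exact Fin.isLt _
      · intro hi
        rw [← hd] at hi
        exact ⟨(en ⟨_, hi⟩).val, (en ⟨_, hi⟩).2, (hg _ _).2 ⟨(en ⟨_, hi⟩).2, by simp⟩⟩
    rw [hset, Set.ncard_image_of_injective _ σ.injective, Set.ncard_eq_toFinset_card',
      Set.toFinset_ofPred, Fin.card_filter_val_lt]

/-- The partial arc colouring obtained by colouring the arcs entering each vertex, in reverse
topological order. -/
theorem exists_arc_coloring [Finite Vt] (D : Dgraph Vt At) (τ : At → ℕ) (s : Vt)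
    (hacyc : D.Acyclic) (k : ℕ)
    (hcond : ∀ (i : ℕ) (v : Vt), v ≠ s →
      min k (D.deltaLe τ v i).card ≤ min k (D.rhoLe τ v i).card) :
    ∃ c : At → Option (Fin k), ∀ v, v ≠ s →
      (∀ e e' i, D.head e = v → D.head e' = v → c e = some i → c e' = some i → e = e') ∧
      (∀ f i, D.tail f = v → c f = some i →
        ∃ e, D.head e = v ∧ τ e ≤ τ f ∧ c e = some i) ∧
      {i | ∃ e, D.head e = v ∧ c e = some i}.ncard = min k (D.indeg v) := by
  have hloc := fun (v : Vt) (c : At → Option (Fin k)) (hv : v ≠ s) =>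
    D.exists_coloring_at τ k v (fun i => hcond i v hv) c
  choose! G hG using hloc
  let F : (v : Vt) → ((w : Vt) → (∃ a, D.tail a = v ∧ D.head a = w) → At → Option (Fin k)) →
      At → Option (Fin k) := fun v col =>
    G v (fun f => if h : D.tail f = v then col (D.head f) ⟨f, h, rfl⟩ f else none)
  let col := hacyc.wellFounded.fix F
  have hcol : ∀ v, col v =
      G v (fun f => if D.tail f = v then col (D.head f) f else none) := by
    intro v
    change hacyc.wellFounded.fix F v = _
    rw [WellFounded.fix_eq]
    simp only [F, dite_eq_ite, col]
  refine ⟨fun e => col (D.head e) e, fun v hv => ?_⟩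
  obtain ⟨h1, h2, h3⟩ := hG v (fun f => if D.tail f = v then col (D.head f) f else none) hv
  rw [← hcol v] at h1 h2 h3
  refine ⟨?_, ?_, ?_⟩
  · intro e e' i he he' hi hi'
    exact h1 e e' i he he' (by simpa only [he] using hi) (by simpa only [he'] using hi')
  · intro f i hf hi
    obtain ⟨e, he, hle, hc⟩ := h2 f i hf (by simpa only [hf, if_true] using hi)
    exact ⟨e, he, hle, by simpa only [he] using hc⟩
  · rw [← h3]
    congr 1
    ext i
    refine exists_congr fun e => and_congr_right fun he => ?_
    simp only [he]

end Dgraph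

/-- In an acyclic temporal network `N = ((V ∪ {s}, A), τ)`, if
`min {k, |ρ^i_N(v)|} ≥ min {k, |δ^i_N(v)|}` for all `i ∈ ℕ` and all `v ∈ V`,
then there is a packing of `k` τ-respecting `s`-arborescences such that each vertex
`v ∈ V` belongs to exactly `min {k, d⁻_D(v)}` of them. -/
theorem packing_acyclic_minCondition
    {Vt At : Type} [Fintype Vt] [DecidableEq Vt] [Fintype At] [DecidableEq At]
    (D : Dgraph Vt At) (τ : At → ℕ) (s : Vt)
    (hroot : ∀ a : At, D.head a ≠ s)
    (hacyc : D.Acyclic)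
    (k : ℕ)
    (hcond : ∀ (i : ℕ) (v : Vt), v ≠ s →
      min k (D.deltaLe τ v i).card ≤ min k (D.rhoLe τ v i).card) :
    ∃ B : Fin k → Finset At,
      (∀ i, D.IsTArb τ s (B i)) ∧
      (∀ i j, i ≠ j → Disjoint (B i) (B j)) ∧
      ∀ v : Vt, v ≠ s →
        (Finset.univ.filter (fun i => v ∈ D.vertsF s (B i))).card =
          min k (D.indeg v) := by
  obtain ⟨c, hc⟩ := D.exists_arc_coloring τ s hacyc k hcond
  let B : Fin k → Finset At := fun i => Finset.univ.filter (fun a => c a = some i)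
  have hB : ∀ i a, a ∈ B i ↔ c a = some i := fun i a => by simp [B]
  have hverts : ∀ i v, v ≠ s → (v ∈ D.vertsF s (B i) ↔ ∃ e, D.head e = v ∧ c e = some i) := by
    intro i v hv
    simp only [Dgraph.vertsF, Finset.mem_insert, hv, false_or, Finset.mem_union,
      Finset.mem_image, hB]
    constructor
    · rintro (⟨a, ha, hav⟩ | ⟨a, ha, hav⟩)
      · obtain ⟨e, he, -, hce⟩ := (hc v hv).2.1 a i hav ha
        exact ⟨e, he, hce⟩
      · exact ⟨a, hav, ha⟩
    · rintro ⟨e, he, hce⟩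
      exact Or.inr ⟨e, hce, he⟩
  have hresp : ∀ i (p : List At) (u v : Vt), (∀ a ∈ p, a ∈ B i) → D.WalkFrom u p v →
      Dgraph.Respects τ p := by
    intro i p
    induction p with
    | nil => intro _ _ _ _; exact List.isChain_nil
    | cons a p ih =>
      intro u v hp hw
      have ih' := ih (D.head a) v (fun b hb => hp b (List.mem_cons_of_mem _ hb)) hw.2
      cases p with
      | nil => exact List.isChain_singleton _
      | cons b q =>
        refine List.isChain_cons_cons.mpr ⟨?_, ih'⟩
        have ha := (hB i a).1 (hp a (by simp))
        have hb := (hB i b).1 (hp b (by simp))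
        obtain ⟨h1, h2, -⟩ := hc (D.head a) (hroot a)
        obtain ⟨e, he, hle, hce⟩ := h2 b i hw.2.1 hb
        rwa [← h1 e a i he rfl hce ha]
  refine ⟨B, fun i => ⟨⟨?_, ?_⟩, ?_⟩, ?_, ?_⟩
  · rintro ⟨v, p, hp, -, hw⟩
    exact hacyc ⟨v, p, hp, fun _ _ => Set.mem_univ _, hw⟩
  · intro v hvB hv
    obtain ⟨e, he, hce⟩ := (hverts i v hv).1 hvB
    refine Finset.card_eq_one.mpr ⟨e, ?_⟩
    ext a
    simp only [Finset.mem_filter, Finset.mem_singleton, hB]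
    constructor
    · rintro ⟨ha, hav⟩
      exact (hc v hv).1 a e i hav he ha hce
    · rintro rfl
      exact ⟨hce, he⟩
  · intro v _ p hp hpath
    exact hresp i p s v hp hpath.1
  · intro i j hij
    rw [Finset.disjoint_left]
    intro a hi hj
    rw [hB] at hi hj
    exact hij (Option.some.inj (hi.symm.trans hj))
  · intro v hv
    rw [← (hc v hv).2.2, ← Set.ncard_coe_finset]
    congr 1
    ext i
    simp [hverts i v hv]
end

section
/- Let N = (D = (V ∪ {s}, A), τ) be a consistent pre-flow temporal network. Then there exists a packing of d^+_D(s) τ-respecting s-arborescences such that each vertex v ∈ V belongs to at least λ_N(s,v) of them. -/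
namespace Dgraph

section Cuts

variable {V E : Type} [DecidableEq V] [DecidableEq E]

/-- The number of arcs of `A` entering `X`, where arcs of `M` do not count if `z ∈ X`. -/
def cutIn (D : Dgraph V E) (A M : Finset E) (z : V) (X : Finset V) : ℕ :=
  (A.filter fun a => D.tail a ∉ X ∧ D.head a ∈ X ∧ (z ∈ X → a ∉ M)).card

theorem cutIn_inter_add_union (D : Dgraph V E) {A M : Finset E} {z : V} {X Y : Finset V}
    (hM : ∀ a ∈ A, a ∈ M → D.tail a ∉ X ∧ D.tail a ∉ Y) :
    D.cutIn A M z (X ∩ Y) + D.cutIn A M z (X ∪ Y) ≤ D.cutIn A M z X + D.cutIn A M z Y := by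
  simp only [cutIn, Finset.card_filter, ← Finset.sum_add_distrib]
  refine Finset.sum_le_sum fun a ha => ?_
  have := hM a ha
  by_cases h1 : D.tail a ∈ X <;> by_cases h2 : D.tail a ∈ Y <;> by_cases h3 : D.head a ∈ X <;>
    by_cases h4 : D.head a ∈ Y <;> by_cases h5 : z ∈ X <;> by_cases h6 : z ∈ Y <;>
    by_cases h7 : a ∈ M <;> simp_all

theorem cutIn_inter_add_union_lt (D : Dgraph V E) {A M : Finset E} {z : V} {X Y : Finset V}
    (hM : ∀ a ∈ A, a ∈ M → D.tail a ∉ X ∧ D.tail a ∉ Y) {f : E} (hf : f ∈ A)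
    (hft : D.tail f ∈ X) (hft' : D.tail f ∉ Y) (hfh : D.head f ∉ X) (hfh' : D.head f ∈ Y) :
    D.cutIn A M z (X ∩ Y) + D.cutIn A M z (X ∪ Y) < D.cutIn A M z X + D.cutIn A M z Y := by
  simp only [cutIn, Finset.card_filter, ← Finset.sum_add_distrib]
  refine Finset.sum_lt_sum (fun a ha => ?_) ⟨f, hf, ?_⟩
  · have := hM a ha
    by_cases h1 : D.tail a ∈ X <;> by_cases h2 : D.tail a ∈ Y <;> by_cases h3 : D.head a ∈ X <;>
      by_cases h4 : D.head a ∈ Y <;> by_cases h5 : z ∈ X <;> by_cases h6 : z ∈ Y <;>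
      by_cases h7 : a ∈ M <;> simp_all
  · have := hM f hf
    have h7 : f ∉ M := fun h => (this h).1 hft
    simp_all

theorem cutIn_sdiff_add_sdiff (D : Dgraph V E) {A M : Finset E} {z : V} {X Y : Finset V}
    (hM : ∀ a ∈ A, a ∈ M → D.tail a ∉ X ∧ D.tail a ∉ Y) (hz : z ∉ X ∩ Y) :
    D.cutIn A M z (X \ Y) + D.cutIn A M z (Y \ X) + (A.filter fun a => D.head a ∈ X ∩ Y).card ≤
      D.cutIn A M z X + D.cutIn A M z Y + (A.filter fun a => D.tail a ∈ X ∩ Y).card := by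
  simp only [cutIn, Finset.card_filter, ← Finset.sum_add_distrib]
  refine Finset.sum_le_sum fun a ha => ?_
  have := hM a ha
  by_cases h1 : D.tail a ∈ X <;> by_cases h2 : D.tail a ∈ Y <;> by_cases h3 : D.head a ∈ X <;>
    by_cases h4 : D.head a ∈ Y <;> by_cases h5 : z ∈ X <;> by_cases h6 : z ∈ Y <;>
    by_cases h7 : a ∈ M <;> simp_all

theorem cutIn_sdiff_add_sdiff_lt (D : Dgraph V E) {A M : Finset E} {z : V} {X Y : Finset V}
    (hM : ∀ a ∈ A, a ∈ M → D.tail a ∉ X ∧ D.tail a ∉ Y) (hz : z ∉ X ∩ Y) {f : E} (hf : f ∈ A)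
    (hfM : f ∉ M)
    (hfe : (D.tail f ∈ X ∩ Y ∧ D.head f ∉ X ∪ Y) ∨ (D.tail f ∉ X ∪ Y ∧ D.head f ∈ X ∩ Y)) :
    D.cutIn A M z (X \ Y) + D.cutIn A M z (Y \ X) + (A.filter fun a => D.head a ∈ X ∩ Y).card <
      D.cutIn A M z X + D.cutIn A M z Y + (A.filter fun a => D.tail a ∈ X ∩ Y).card := by
  simp only [cutIn, Finset.card_filter, ← Finset.sum_add_distrib]
  refine Finset.sum_lt_sum (fun a ha => ?_) ⟨f, hf, ?_⟩
  · have := hM a ha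
    by_cases h1 : D.tail a ∈ X <;> by_cases h2 : D.tail a ∈ Y <;> by_cases h3 : D.head a ∈ X <;>
      by_cases h4 : D.head a ∈ Y <;> by_cases h5 : z ∈ X <;> by_cases h6 : z ∈ Y <;>
      by_cases h7 : a ∈ M <;> simp_all
  · rcases hfe with h | h <;> simp_all

/-- A digraph on `S ∪ {s, z}` with root `s` that is pre-flow on `S`, in which every set `X`
is entered by at least `r x` arcs for `x ∈ X`; for sets containing `z` only the requirement of `z`
matters, and the root arcs in `M` do not help to fulfil it. -/
structure IsNet (D : Dgraph V E) (A M : Finset E) (s z : V) (S : Finset V) (r : V → ℕ) :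
    Prop where
  s_notMem : s ∉ S
  z_notMem : z ∉ S
  s_ne_z : s ≠ z
  tail_mem : ∀ a ∈ A, D.tail a ∈ insert s S
  head_mem : ∀ a ∈ A, D.head a ∈ insert z S
  tail_of_mem : ∀ a ∈ A, a ∈ M → D.tail a = s
  preflow : ∀ v ∈ S, (A.filter fun a => D.tail a = v).card ≤ (A.filter fun a => D.head a = v).card
  cut : ∀ X ⊆ insert z S, ∀ x ∈ X, (z ∈ X → x = z) → r x ≤ D.cutIn A M z X

variable {D : Dgraph V E} {A M : Finset E} {s z : V} {S : Finset V} {r : V → ℕ}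

namespace IsNet

theorem s_notMem_of_subset (h : D.IsNet A M s z S r) {X : Finset V} (hX : X ⊆ insert z S) :
    s ∉ X := fun hs => by
  rcases Finset.mem_insert.1 (hX hs) with h' | h'
  · exact h.s_ne_z h'
  · exact h.s_notMem h'

theorem preflow_set (h : D.IsNet A M s z S r) {Z : Finset V} (hZ : Z ⊆ S) :
    (A.filter fun a => D.tail a ∈ Z).card ≤ (A.filter fun a => D.head a ∈ Z).card := by
  rw [Finset.card_eq_sum_card_fiberwise (f := D.tail) (t := Z) (fun a ha => by simp_all),
    Finset.card_eq_sum_card_fiberwise (f := D.head) (t := Z) (fun a ha => by simp_all)]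
  refine Finset.sum_le_sum fun v hv => ?_
  have key : ∀ g : E → V, ((A.filter fun a => g a ∈ Z).filter fun a => g a = v) =
      A.filter fun a => g a = v := fun g => by
    ext a
    simp only [Finset.mem_filter]
    grind
  rw [key, key]
  exact h.preflow v (hZ hv)

end IsNet

/-- `X` is a set whose cut condition for some `x ≠ v` is tight. -/
def TightSet (D : Dgraph V E) (A M : Finset E) (z : V) (S : Finset V) (r : V → ℕ) (v : V)
    (X : Finset V) : Prop :=
  X ⊆ insert z S ∧ ∃ x ∈ X, (z ∈ X → x = z) ∧ x ≠ v ∧ D.cutIn A M z X ≤ r x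

namespace IsNet

theorem tight_uncross (h : D.IsNet A M s z S r) {v : V} {X Y : Finset V}
    (hX : D.TightSet A M z S r v X) (hY : D.TightSet A M z S r v Y) :
    (D.TightSet A M z S r v (X ∩ Y) ∧ D.TightSet A M z S r v (X ∪ Y) ∧
      ∀ f ∈ A, D.tail f ∈ X → D.tail f ∉ Y → D.head f ∉ X → D.head f ∈ Y → False) ∨
    (D.TightSet A M z S r v (X \ Y) ∧
      ∀ f ∈ A, f ∉ M → ¬ ((D.tail f ∈ X ∩ Y ∧ D.head f ∉ X ∪ Y) ∨
        (D.tail f ∉ X ∪ Y ∧ D.head f ∈ X ∩ Y))) := by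
  obtain ⟨hXS, x, hxX, hxz, hxv, hx⟩ := hX
  obtain ⟨hYS, y, hyY, hyz, hyv, hy⟩ := hY
  have hM : ∀ a ∈ A, a ∈ M → D.tail a ∉ X ∧ D.tail a ∉ Y := fun a ha haM => by
    rw [h.tail_of_mem a ha haM]
    exact ⟨h.s_notMem_of_subset hXS, h.s_notMem_of_subset hYS⟩
  have hI : X ∩ Y ⊆ insert z S := Finset.inter_subset_left.trans hXS
  have hU : X ∪ Y ⊆ insert z S := Finset.union_subset hXS hYS
  have hsub := D.cutIn_inter_add_union (z := z) hM
  by_cases hxY : x ∈ Y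
  · left
    have h1 := h.cut _ hI x (by simp [*]) (by simp; tauto)
    have h2 := h.cut _ hU y (by simp [*]) (by simp; grind)
    refine ⟨⟨hI, x, by simp [*], by simp; tauto, hxv, by omega⟩,
      ⟨hU, y, by simp [*], by simp; grind, hyv, by omega⟩, fun f hf a1 a2 a3 a4 => ?_⟩
    have := D.cutIn_inter_add_union_lt (z := z) hM hf a1 a2 a3 a4
    omega
  by_cases hyX : y ∈ X
  · left
    have h1 := h.cut _ hI y (by simp [*]) (by simp; tauto)
    have h2 := h.cut _ hU x (by simp [*]) (by simp; grind)
    refine ⟨⟨hI, y, by simp [*], by simp; tauto, hyv, by omega⟩,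
      ⟨hU, x, by simp [*], by simp; grind, hxv, by omega⟩, fun f hf a1 a2 a3 a4 => ?_⟩
    have := D.cutIn_inter_add_union_lt (z := z) hM hf a1 a2 a3 a4
    omega
  right
  have hz : z ∉ X ∩ Y := by simp; grind
  have h1 := h.cut (X \ Y) (Finset.sdiff_subset.trans hXS) x (by simp [*]) (by simp; tauto)
  have h2 := h.cut (Y \ X) (Finset.sdiff_subset.trans hYS) y (by simp [*]) (by simp; tauto)
  have hp := h.preflow_set (Z := X ∩ Y) fun a ha => by
    have := hI ha
    grind
  have hd := D.cutIn_sdiff_add_sdiff hM hz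
  refine ⟨⟨Finset.sdiff_subset.trans hXS, x, by simp [*], by simp; tauto, hxv, by omega⟩,
    fun f hf hfM hfe => ?_⟩
  have := D.cutIn_sdiff_add_sdiff_lt hM hz hf hfM hfe
  omega

end IsNet

end Cuts
end Dgraph

namespace Dgraph

section Split

variable {V E : Type} [DecidableEq E]

/-- The digraph obtained by moving the head of the arc `e` to `w`. -/
def moveHead (D : Dgraph V E) (e : E) (w : V) : Dgraph V E :=
  ⟨D.tail, Function.update D.head e w⟩

@[simp] theorem moveHead_tail (D : Dgraph V E) (e : E) (w : V) (a : E) :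
    (D.moveHead e w).tail a = D.tail a := rfl

@[simp] theorem moveHead_head_self (D : Dgraph V E) (e : E) (w : V) :
    (D.moveHead e w).head e = w := by simp [moveHead]

theorem moveHead_head_of_ne (D : Dgraph V E) {e a : E} (w : V) (h : a ≠ e) :
    (D.moveHead e w).head a = D.head a := by simp [moveHead, h]

variable [DecidableEq V] {D : Dgraph V E} {A M : Finset E} {s z : V} {S : Finset V} {r : V → ℕ}

theorem sum_eq_add_add_erase {g : E → ℕ} {e f : E} (he : e ∈ A) (hf : f ∈ A) (hef : e ≠ f) :
    ∑ a ∈ A, g a = g f + (g e + ∑ a ∈ (A.erase f).erase e, g a) := by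
  rw [Finset.add_sum_erase (A.erase f) g (Finset.mem_erase.2 ⟨hef, he⟩),
    Finset.add_sum_erase A g hf]

theorem cutIn_moveHead {e f : E} (he : e ∈ A) (hf : f ∈ A) (hfM : f ∉ M)
    (hef : D.head e = D.tail f) (hf' : D.tail f ≠ D.head f) {X : Finset V}
    (hlt : (D.moveHead e (D.head f)).cutIn (A.erase f) M z X < D.cutIn A M z X) :
    D.cutIn A M z X ≤ (D.moveHead e (D.head f)).cutIn (A.erase f) M z X + 1 ∧
    ((D.tail f ∈ X ∧ D.head f ∉ X ∧ D.tail e ∉ X ∧ (z ∈ X → e ∉ M)) ∨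
      (D.tail f ∉ X ∧ D.head f ∈ X ∧ (D.tail e ∈ X ∨ (z ∈ X ∧ e ∈ M)))) := by
  have hne : e ≠ f := by rintro rfl; exact hf' hef.symm
  have hR : ∑ a ∈ (A.erase f).erase e, (if (D.moveHead e (D.head f)).tail a ∉ X ∧
      (D.moveHead e (D.head f)).head a ∈ X ∧ (z ∈ X → a ∉ M) then 1 else 0) =
      ∑ a ∈ (A.erase f).erase e, (if D.tail a ∉ X ∧ D.head a ∈ X ∧ (z ∈ X → a ∉ M)
        then 1 else 0) := Finset.sum_congr rfl fun a ha => by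
    rw [moveHead_head_of_ne _ _ (Finset.mem_erase.1 ha).1, moveHead_tail]
  simp only [cutIn, Finset.card_filter] at hlt ⊢
  rw [sum_eq_add_add_erase he hf hne, ← Finset.add_sum_erase (A.erase f) _
    (Finset.mem_erase.2 ⟨hne, he⟩), hR] at hlt ⊢
  generalize (∑ a ∈ (A.erase f).erase e,
    (if D.tail a ∉ X ∧ D.head a ∈ X ∧ (z ∈ X → a ∉ M) then 1 else 0)) = R at hlt ⊢
  clear hR
  simp only [moveHead_tail, moveHead_head_self, hef] at hlt ⊢
  by_cases h1 : D.tail f ∈ X <;> by_cases h2 : D.head f ∈ X <;> by_cases h3 : D.tail e ∈ X <;>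
    by_cases h4 : z ∈ X <;> by_cases h5 : e ∈ M <;> simp_all <;> omega

namespace IsNet

theorem exists_tight_of_not_moveHead (h : D.IsNet A M s z S r) {v : V} (hv : v ∈ S)
    (hrv : r v = 0) {e f : E} (he : e ∈ A) (hf : f ∈ A) (hev : D.head e = v)
    (hfv : D.tail f = v) (hfh : D.head f ≠ v)
    (hnot : ¬ (D.moveHead e (D.head f)).IsNet (A.erase f) M s z S r) :
    ∃ X, D.TightSet A M z S r v X ∧
    ((v ∈ X ∧ D.head f ∉ X ∧ D.tail e ∉ X ∧ (z ∈ X → e ∉ M)) ∨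
      (v ∉ X ∧ D.head f ∈ X ∧ (D.tail e ∈ X ∨ (z ∈ X ∧ e ∈ M)))) := by
  have hvs : v ≠ s := fun hvs => h.s_notMem (hvs ▸ hv)
  have hne : e ≠ f := by rintro rfl; exact hfh hev
  have hfM : f ∉ M := fun hm => hvs (hfv ▸ h.tail_of_mem f hf hm)
  by_contra hcon
  refine hnot ⟨h.s_notMem, h.z_notMem, h.s_ne_z, fun a ha => h.tail_mem a (Finset.mem_of_mem_erase ha),
    fun a ha => ?_, fun a ha => h.tail_of_mem a (Finset.mem_of_mem_erase ha), fun x hx => ?_,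
    fun X hX x hxX hzx => ?_⟩
  · by_cases hae : a = e
    · subst hae
      simpa using h.head_mem f hf
    · rw [moveHead_head_of_ne _ _ hae]
      exact h.head_mem a (Finset.mem_of_mem_erase ha)
  · have hp := h.preflow x hx
    change ((A.erase f).filter fun a => D.tail a = x).card ≤ _
    simp only [Finset.card_filter] at hp ⊢
    have hef : e ∈ A.erase f := Finset.mem_erase.2 ⟨hne, he⟩
    rw [sum_eq_add_add_erase he hf hne, sum_eq_add_add_erase he hf hne] at hp
    rw [← Finset.add_sum_erase (A.erase f) _ hef, ← Finset.add_sum_erase (A.erase f) _ hef]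
    have hR : ∑ a ∈ (A.erase f).erase e, (if (D.moveHead e (D.head f)).head a = x then 1 else 0) =
        ∑ a ∈ (A.erase f).erase e, (if D.head a = x then 1 else 0) :=
      Finset.sum_congr rfl fun a ha => by
        rw [moveHead_head_of_ne _ _ (Finset.mem_erase.1 ha).1]
    rw [hR]
    simp only [moveHead_head_self, hfv, hev] at hp ⊢
    omega
  · by_contra hlt
    push Not at hlt
    have hc := h.cut X hX x hxX hzx
    obtain ⟨h1, h2⟩ := cutIn_moveHead he hf hfM (hev.trans hfv.symm) (hfv ▸ hfh.symm)
      (lt_of_lt_of_le hlt hc)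
    rw [hfv] at h2
    refine hcon ⟨X, ⟨hX, x, hxX, hzx, ?_, by omega⟩, h2⟩
    rintro rfl
    omega

theorem not_all_tail_notMem (h : D.IsNet A M s z S r) {v : V} (hv : v ∈ S)
    (hloop : ∀ a ∈ A, D.tail a = v → D.head a ≠ v) {f : E} (hf : f ∈ A) (hfv : D.tail f = v)
    {X : Finset V} (hX : D.TightSet A M z S r v X) (hvX : v ∈ X) (hfX : D.head f ∉ X)
    (hall : ∀ e ∈ A, D.head e = v → D.tail e ∉ X ∧ (z ∈ X → e ∉ M)) : False := by
  obtain ⟨hXS, x, hxX, hxz, hxv, hx⟩ := hX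
  have hc := h.cut (X.erase v) ((Finset.erase_subset _ _).trans hXS) x
    (Finset.mem_erase.2 ⟨hxv, hxX⟩) (fun hz => hxz (Finset.mem_of_mem_erase hz))
  have hp := h.preflow v hv
  have key : D.cutIn A M z (X.erase v) + (A.filter fun a => D.head a = v).card <
      D.cutIn A M z X + (A.filter fun a => D.tail a = v).card := by
    have hvz : v ≠ z := fun hvz => h.z_notMem (hvz ▸ hv)
    have hsX := h.s_notMem_of_subset hXS
    simp only [cutIn, Finset.card_filter, ← Finset.sum_add_distrib]
    refine Finset.sum_lt_sum (fun a ha => ?_) ⟨f, hf, ?_⟩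
    · have a1 := hall a ha
      have a2 := hloop a ha
      have a3 := h.tail_of_mem a ha
      by_cases h1 : D.tail a = v <;> by_cases h2 : D.head a = v <;> by_cases h3 : D.tail a ∈ X <;>
        by_cases h4 : D.head a ∈ X <;> by_cases h5 : z ∈ X <;> by_cases h7 : a ∈ M <;>
        simp_all
    · have := hloop f hf hfv
      simp_all
  omega

theorem not_all_tail_mem (h : D.IsNet A M s z S r) {v : V} (hv : v ∈ S)
    {f : E} (hf : f ∈ A) (hfv : D.tail f = v)
    {Y : Finset V} (hY : D.TightSet A M z S r v Y) (hvY : v ∉ Y) (hfY : D.head f ∈ Y)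
    (hall : ∀ e ∈ A, D.head e = v → D.tail e ∈ Y ∨ (z ∈ Y ∧ e ∈ M)) : False := by
  obtain ⟨hYS, y, hyY, hyz, hyv, hy⟩ := hY
  have hvz : z ≠ v := fun hvz => h.z_notMem (hvz ▸ hv)
  have hvs : v ≠ s := fun hvs => h.s_notMem (hvs ▸ hv)
  have hc := h.cut (insert v Y) (Finset.insert_subset (Finset.mem_insert_of_mem hv) hYS) y
    (Finset.mem_insert_of_mem hyY) (fun hz => hyz ((Finset.mem_insert.1 hz).resolve_left hvz))
  have key : D.cutIn A M z (insert v Y) < D.cutIn A M z Y := by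
    simp only [cutIn, Finset.card_filter]
    refine Finset.sum_lt_sum (fun a ha => ?_) ⟨f, hf, ?_⟩
    · have a1 := hall a ha
      by_cases h1 : D.tail a = v <;> by_cases h2 : D.head a = v <;> by_cases h3 : D.tail a ∈ Y <;>
        by_cases h4 : D.head a ∈ Y <;> by_cases h5 : z ∈ Y <;> by_cases h7 : a ∈ M <;>
        simp_all
    · have hfM : f ∉ M := fun hm => hvs (hfv ▸ h.tail_of_mem f hf hm)
      simp_all
  omega

/-- Any arc leaving `v` can be split off with some arc entering `v`. -/
theorem exists_moveHead (h : D.IsNet A M s z S r) {v : V} (hv : v ∈ S) (hrv : r v = 0)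
    (hloop : ∀ a ∈ A, D.tail a = v → D.head a ≠ v) {f : E} (hf : f ∈ A) (hfv : D.tail f = v) :
    ∃ e ∈ A, D.head e = v ∧ (D.moveHead e (D.head f)).IsNet (A.erase f) M s z S r := by
  classical
  by_contra hcon
  push Not at hcon
  have hblock := fun e (he : e ∈ A) (hev : D.head e = v) =>
    h.exists_tight_of_not_moveHead hv hrv he hf hev hfv (hloop f hf hfv) (hcon e he hev)
  have hvs : v ≠ s := fun hvs => h.s_notMem (hvs ▸ hv)
  have hfM : f ∉ M := fun hm => hvs (hfv ▸ h.tail_of_mem f hf hm)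
  have hfw := hloop f hf hfv
  generalize hw : D.head f = w at hblock hcon hfw
  let 𝒜 := (insert z S).powerset.filter fun X => D.TightSet A M z S r v X ∧ v ∈ X ∧ w ∉ X
  let ℬ := (insert z S).powerset.filter fun X => D.TightSet A M z S r v X ∧ v ∉ X ∧ w ∈ X
  have mem𝒜 : ∀ {X}, X ∈ 𝒜 ↔ D.TightSet A M z S r v X ∧ v ∈ X ∧ w ∉ X := fun {X} => by
    simp only [𝒜, Finset.mem_filter, Finset.mem_powerset, and_iff_right_iff_imp]
    exact fun h => h.1.1
  have memℬ : ∀ {X}, X ∈ ℬ ↔ D.TightSet A M z S r v X ∧ v ∉ X ∧ w ∈ X := fun {X} => by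
    simp only [ℬ, Finset.mem_filter, Finset.mem_powerset, and_iff_right_iff_imp]
    exact fun h => h.1.1
  have inter𝒜 : ∀ X ∈ 𝒜, ∀ Y ∈ 𝒜, X ∩ Y ∈ 𝒜 := fun X hX Y hY => by
    obtain ⟨hX1, hX2, hX3⟩ := mem𝒜.1 hX
    obtain ⟨hY1, hY2, hY3⟩ := mem𝒜.1 hY
    rcases h.tight_uncross hX1 hY1 with ⟨h1, -, -⟩ | ⟨-, h2⟩
    · exact mem𝒜.2 ⟨h1, by simp [*], by simp [*]⟩
    · exact (h2 f hf hfM (Or.inl ⟨by simp [*], by simp [*]⟩)).elim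
  have unionℬ : ∀ X ∈ ℬ, ∀ Y ∈ ℬ, X ∪ Y ∈ ℬ := fun X hX Y hY => by
    obtain ⟨hX1, hX2, hX3⟩ := memℬ.1 hX
    obtain ⟨hY1, hY2, hY3⟩ := memℬ.1 hY
    rcases h.tight_uncross hX1 hY1 with ⟨-, h1, -⟩ | ⟨-, h2⟩
    · exact memℬ.2 ⟨h1, by simp [*], by simp [*]⟩
    · exact (h2 f hf hfM (Or.inr ⟨by simp [*], by simp [*]⟩)).elim
  have sdiff𝒜 : ∀ X ∈ 𝒜, ∀ Y ∈ ℬ, X \ Y ∈ 𝒜 := fun X hX Y hY => by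
    obtain ⟨hX1, hX2, hX3⟩ := mem𝒜.1 hX
    obtain ⟨hY1, hY2, hY3⟩ := memℬ.1 hY
    rcases h.tight_uncross hX1 hY1 with ⟨-, -, h1⟩ | ⟨h2, -⟩
    · exact (h1 f hf (hfv ▸ hX2) (hfv ▸ hY2) (hw ▸ hX3) (hw ▸ hY3)).elim
    · exact mem𝒜.2 ⟨h2, by simp [*], by simp [*]⟩
  have min𝒜 : 𝒜.Nonempty → ∃ X ∈ 𝒜, ∀ Y ∈ 𝒜, X ⊆ Y := fun hne => by
    obtain ⟨X, hX, hmin⟩ := Finset.exists_min_image 𝒜 Finset.card hne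
    refine ⟨X, hX, fun Y hY => ?_⟩
    rw [← Finset.eq_of_subset_of_card_le Finset.inter_subset_left (hmin _ (inter𝒜 X hX Y hY))]
    exact Finset.inter_subset_right
  have maxℬ : ℬ.Nonempty → ∃ X ∈ ℬ, ∀ Y ∈ ℬ, Y ⊆ X := fun hne => by
    obtain ⟨X, hX, hmax⟩ := Finset.exists_max_image ℬ Finset.card hne
    refine ⟨X, hX, fun Y hY => ?_⟩
    rw [Finset.eq_of_subset_of_card_le Finset.subset_union_left (hmax _ (unionℬ X hX Y hY))]
    exact Finset.subset_union_right
  by_cases hA : 𝒜.Nonempty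
  · obtain ⟨X, hX, hXmin⟩ := min𝒜 hA
    obtain ⟨hX1, hX2, hX3⟩ := mem𝒜.1 hX
    refine h.not_all_tail_notMem hv hloop hf hfv hX1 hX2 (hw ▸ hX3) fun e he hev => ?_
    obtain ⟨Y, hYt, ⟨h1, h2, h3, h4⟩ | ⟨h1, h2, h3⟩⟩ := hblock e he hev
    · have hXY := hXmin Y (mem𝒜.2 ⟨hYt, h1, h2⟩)
      exact ⟨fun h' => h3 (hXY h'), fun h' => h4 (hXY h')⟩
    · have hXY := hXmin _ (sdiff𝒜 X hX Y (memℬ.2 ⟨hYt, h1, h2⟩))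
      have hdis : ∀ x ∈ X, x ∉ Y := fun x hx => (Finset.mem_sdiff.1 (hXY hx)).2
      rcases h3 with h3 | ⟨h3, h4⟩
      · exact ⟨fun h' => hdis _ h' h3, fun _ heM => h.s_notMem_of_subset hYt.1
          (h.tail_of_mem e he heM ▸ h3)⟩
      · exact ⟨fun h' => h.s_notMem_of_subset hX1.1 (h.tail_of_mem e he h4 ▸ h'),
          fun h' => (hdis _ h' h3).elim⟩
  · have hall : ∀ e ∈ A, D.head e = v →
        ∃ Y ∈ ℬ, D.tail e ∈ Y ∨ (z ∈ Y ∧ e ∈ M) := fun e he hev => by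
      obtain ⟨Y, hYt, ⟨h1, h2, h3, h4⟩ | ⟨h1, h2, h3⟩⟩ := hblock e he hev
      · exact (hA ⟨Y, mem𝒜.2 ⟨hYt, h1, h2⟩⟩).elim
      · exact ⟨Y, memℬ.2 ⟨hYt, h1, h2⟩, h3⟩
    have hin : (A.filter fun a => D.head a = v).Nonempty := by
      rw [← Finset.card_pos]
      exact lt_of_lt_of_le (Finset.card_pos.2 ⟨f, by simp [*]⟩) (h.preflow v hv)
    obtain ⟨e₀, he₀⟩ := hin
    rw [Finset.mem_filter] at he₀
    obtain ⟨Y₀, hY₀, -⟩ := hall e₀ he₀.1 he₀.2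
    obtain ⟨Y, hY, hYmax⟩ := maxℬ ⟨Y₀, hY₀⟩
    obtain ⟨hY1, hY2, hY3⟩ := memℬ.1 hY
    refine h.not_all_tail_mem hv hf hfv hY1 hY2 (hw ▸ hY3) fun e he hev => ?_
    obtain ⟨Y', hY', h'⟩ := hall e he hev
    have := hYmax Y' hY'
    grind

end IsNet

end Split
end Dgraph

namespace Dgraph

section Packing

variable {V E : Type}

/-- A partial colouring of the arcs of `A` by root arcs such that each colour class is an
`s`-arborescence whose only root arc is the colour itself, avoiding `z` if the colour is in `M`. -/
structure IsPacking (D : Dgraph V E) (A M : Finset E) (s z : V) (c : E → Option E) : Prop where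
  mem : ∀ a e, c a = some e → a ∈ A ∧ e ∈ A ∧ D.tail e = s
  root : ∀ a e, c a = some e → D.tail a = s → e = a
  parent : ∀ a e, c a = some e → D.tail a ≠ s → ∃ b, c b = some e ∧ D.head b = D.tail a
  unique : ∀ a b e, c a = some e → c b = some e → D.head a = D.head b → a = b
  rank : ∀ e, ∃ h : V → ℕ, ∀ a, c a = some e → h (D.tail a) < h (D.head a)
  avoid : ∀ a e, c a = some e → D.head a = z → e ∉ M

open Classical in
/-- The colours whose arborescence contains `x`. -/
noncomputable def covering (D : Dgraph V E) (A : Finset E) (c : E → Option E) (x : V) : Finset E :=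
  A.filter fun e => ∃ a, c a = some e ∧ D.head a = x

variable {D : Dgraph V E} {A M : Finset E} {s z : V} {S : Finset V} {r : V → ℕ}
  {c : E → Option E}

theorem mem_covering {x : V} {e : E} :
    e ∈ D.covering A c x ↔ e ∈ A ∧ ∃ a, c a = some e ∧ D.head a = x := by
  simp [covering]

namespace IsPacking

theorem color_root (h : D.IsPacking A M s z c) {a e : E} (ha : c a = some e) : c e = some e := by
  obtain ⟨k, hk⟩ := h.rank e
  induction hn : k (D.tail a) using Nat.strong_induction_on generalizing a with
  | _ n ih =>
    by_cases hs : D.tail a = s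
    · rwa [← h.root a e ha hs] at ha
    · obtain ⟨b, hb, hba⟩ := h.parent a e ha hs
      exact ih _ (by rw [← hn, ← hba]; exact hk b hb) hb rfl

variable [DecidableEq V] [DecidableEq E]

theorem exists_covering_lt (hN : D.IsNet A M s z S r) (h : D.IsPacking A M s z c) {v : V}
    (hv : v ∈ S) (hlt : (D.covering A c v).card < D.cutIn A M z {v})
    (hu : ∀ u ∈ S, u ≠ v → (D.covering A c v).card < (D.covering A c u).card) :
    ∃ c', D.IsPacking A M s z c' ∧ (D.covering A c v).card < (D.covering A c' v).card ∧
      ∀ x, D.covering A c x ⊆ D.covering A c' x := by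
  have hvz : v ≠ z := fun h' => hN.z_notMem (h' ▸ hv)
  have hvs : v ≠ s := fun h' => hN.s_notMem (h' ▸ hv)
  obtain ⟨a, haA, hat, hah, hca⟩ :
      ∃ a ∈ A, D.tail a ≠ v ∧ D.head a = v ∧ c a = none := by
    by_contra hcon
    push Not at hcon
    refine hlt.not_ge ?_
    have hex : ∀ a ∈ A, D.tail a ≠ v → D.head a = v → ∃ e, c a = some e := fun a h1 h2 h3 =>
      Option.ne_none_iff_exists'.1 (hcon a h1 h2 h3)
    refine Finset.card_le_card_of_injOn (fun a => (c a).getD a) (fun a ha => ?_)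
      (fun a ha b hb hab => ?_)
    · simp only [Finset.coe_filter, Finset.mem_singleton, Set.mem_ofPred_eq] at ha
      obtain ⟨e, he⟩ := hex a ha.1 ha.2.1 ha.2.2.1
      simp only [he, Option.getD_some, Finset.mem_coe]
      exact mem_covering.2 ⟨(h.mem a e he).2.1, a, he, ha.2.2.1⟩
    · simp only [Finset.coe_filter, Finset.mem_singleton, Set.mem_ofPred_eq] at ha hb
      obtain ⟨e, he⟩ := hex a ha.1 ha.2.1 ha.2.2.1
      obtain ⟨e', he'⟩ := hex b hb.1 hb.2.1 hb.2.2.1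
      simp only [he, he', Option.getD_some] at hab
      subst hab
      exact h.unique a b e he he' (ha.2.2.1.trans hb.2.2.1.symm)
  obtain ⟨i, hiA, his, hroot, hpar, hiv⟩ : ∃ i ∈ A, D.tail i = s ∧ (D.tail a = s → i = a) ∧
      (D.tail a ≠ s → ∃ b, c b = some i ∧ D.head b = D.tail a) ∧
      ∀ b, c b = some i → D.head b ≠ v := by
    by_cases hs : D.tail a = s
    · refine ⟨a, haA, hs, fun _ => rfl, fun h' => (h' hs).elim, fun b hb _ => ?_⟩
      rw [h.color_root hb] at hca
      cases hca
    · have hus : D.tail a ∈ S := (Finset.mem_insert.1 (hN.tail_mem a haA)).resolve_left hs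
      obtain ⟨i, hi, hi'⟩ := Finset.exists_mem_notMem_of_card_lt_card (hu _ hus hat)
      obtain ⟨hiA, b, hb, hb'⟩ := mem_covering.1 hi
      refine ⟨i, hiA, (h.mem b i hb).2.2, fun h' => (hs h').elim, fun _ => ⟨b, hb, hb'⟩,
        fun b' hb' hv' => hi' (mem_covering.2 ⟨hiA, b', hb', hv'⟩)⟩
  have hne : ∀ {b e}, c b = some e → b ≠ a := by
    rintro b e hb rfl
    rw [hca] at hb
    cases hb
  have hold : ∀ {b e}, c b = some e → Function.update c a (some i) b = some e := fun hb => by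
    rw [Function.update_of_ne (hne hb), hb]
  have hnew : ∀ {b e}, Function.update c a (some i) b = some e →
      (b = a ∧ e = i) ∨ (b ≠ a ∧ c b = some e) := fun {b e} hb => by
    by_cases hba : b = a
    · subst hba
      simp only [Function.update_self, Option.some.injEq] at hb
      exact Or.inl ⟨rfl, hb.symm⟩
    · rw [Function.update_of_ne hba] at hb
      exact Or.inr ⟨hba, hb⟩
  have hsub : ∀ x, D.covering A c x ⊆ D.covering A (Function.update c a (some i)) x :=
    fun x e he => by
      obtain ⟨h1, b, hb, hbx⟩ := mem_covering.1 he
      exact mem_covering.2 ⟨h1, b, hold hb, hbx⟩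
  refine ⟨Function.update c a (some i), ⟨fun b e hb => ?_, fun b e hb hbs => ?_,
    fun b e hb hbs => ?_, fun b b' e hb hb' hbb => ?_, fun e => ?_, fun b e hb hbz => ?_⟩,
    Finset.card_lt_card ((Finset.ssubset_iff_of_subset (hsub v)).2 ⟨i, mem_covering.2
      ⟨hiA, a, by simp, hah⟩, fun hi => ?_⟩), hsub⟩
  · rcases hnew hb with ⟨rfl, rfl⟩ | ⟨-, hb⟩
    exacts [⟨haA, hiA, his⟩, h.mem b e hb]
  · rcases hnew hb with ⟨rfl, rfl⟩ | ⟨-, hb⟩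
    exacts [hroot hbs, h.root b e hb hbs]
  · rcases hnew hb with ⟨rfl, rfl⟩ | ⟨-, hb⟩
    · obtain ⟨b', hb', hb''⟩ := hpar hbs
      exact ⟨b', hold hb', hb''⟩
    · obtain ⟨b', hb', hb''⟩ := h.parent b e hb hbs
      exact ⟨b', hold hb', hb''⟩
  · rcases hnew hb with ⟨h1, h2⟩ | ⟨-, h1⟩ <;> rcases hnew hb' with ⟨h3, h4⟩ | ⟨-, h3⟩
    · exact h1.trans h3.symm
    · exact (hiv b' (h2 ▸ h3) (by rw [← hbb, h1, hah])).elim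
    · exact (hiv b (h4 ▸ h1) (by rw [hbb, h3, hah])).elim
    · exact h.unique b b' e h1 h3 hbb
  · obtain ⟨k, hk⟩ := h.rank e
    by_cases hei : e = i
    · subst hei
      refine ⟨fun x => if x = v then k (D.tail a) + k v + 1 else k x, fun b hb => ?_⟩
      rcases hnew hb with ⟨rfl, -⟩ | ⟨-, hb⟩
      · simp only [hat, hah, if_true, if_false]
        omega
      · have := hk b hb
        have hbv := hiv b hb
        simp only [hbv, if_false]
        split_ifs with hbt
        · obtain ⟨b', hb', hb''⟩ := h.parent b e hb (hbt ▸ hvs)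
          exact (hiv b' hb' (hb''.trans hbt)).elim
        · exact this
    · refine ⟨k, fun b hb => ?_⟩
      rcases hnew hb with ⟨-, h'⟩ | ⟨-, hb⟩
      exacts [(hei h').elim, hk b hb]
  · rcases hnew hb with ⟨rfl, rfl⟩ | ⟨-, hb⟩
    exacts [(hvz (hah.symm.trans hbz)).elim, h.avoid b e hb hbz]
  · obtain ⟨-, b, hb, hbv⟩ := mem_covering.1 hi
    exact hiv b hb hbv

theorem mono (h : D.IsPacking A M s z c) {B : Finset E} (hAB : A ⊆ B) : D.IsPacking B M s z c :=
  ⟨fun a e ha => ⟨hAB (h.mem a e ha).1, hAB (h.mem a e ha).2.1, (h.mem a e ha).2.2⟩, h.root,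
    h.parent, h.unique, h.rank, h.avoid⟩

end IsPacking

end Packing
end Dgraph

namespace Dgraph
namespace IsPacking

variable {V E : Type} [DecidableEq V] [DecidableEq E] {D : Dgraph V E} {A M : Finset E} {s z : V}
  {c : E → Option E}

/-- Undoing the splitting of the arcs `e` and `f` at the vertex `v`. -/
theorem of_moveHead {e f : E} {v w : V} (hf : f ∈ A) (hte : D.tail e ≠ v) (hvs : v ≠ s)
    (hvz : v ≠ z) (hev : D.head e = v) (hfv : D.tail f = v) (hfw : D.head f = w) (hwv : w ≠ v)
    (h : (D.moveHead e w).IsPacking (A.erase f) M s z c) :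
    ∃ c', D.IsPacking A M s z c' ∧
      ∀ x ≠ v, (D.moveHead e w).covering (A.erase f) c x ⊆ D.covering A c' x := by
  have hfe : f ≠ e := by rintro rfl; exact hwv (hfw.symm.trans hev)
  have hcf : c f = none := by
    rcases hc : c f with _ | i
    · rfl
    · exact (Finset.notMem_erase f A (h.mem f i hc).1).elim
  have Hh : ∀ a, (D.moveHead e w).head a = if a = e then w else D.head a := fun a => by
    split_ifs with ha
    · rw [ha, moveHead_head_self]
    · exact moveHead_head_of_ne _ _ ha
  obtain ⟨hmem, hroot, hpar, huniq, hrank, havoid⟩ := h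
  simp only [moveHead_tail, Hh, mem_covering, Finset.subset_iff, Finset.mem_erase] at *
  clear Hh
  rcases hce : c e with _ | i
  · refine ⟨c, ⟨by grind, hroot, by grind, by grind, fun j => ?_, by grind⟩, by grind⟩
    obtain ⟨k, hk⟩ := hrank j
    exact ⟨k, by grind⟩
  · by_cases hcov : ∃ b, c b = some i ∧ b ≠ e ∧ D.head b = v
    · obtain ⟨b, hb, hbe, hbv⟩ := hcov
      have hbf : b ≠ f := by grind
      obtain ⟨k, hk⟩ := hrank i
      by_cases hvw : k v < k w
      · obtain ⟨c', hc'⟩ : ∃ c' : E → Option E,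
            ∀ a, c' a = if a = e then none else if a = f then some i else c a :=
          ⟨_, fun _ => rfl⟩
        refine ⟨c', ⟨by grind, by grind, ?_, ?_, fun j => ?_, by grind⟩, ?_⟩
        · grind
        · grind
        · by_cases hji : j = i
          · exact ⟨k, by grind⟩
          · obtain ⟨k', hk'⟩ := hrank j
            exact ⟨k', by grind⟩
        · grind
      · obtain ⟨c', hc'⟩ : ∃ c' : E → Option E,
            ∀ a, c' a = if a = b then none else if a = f then some i else c a :=
          ⟨_, fun _ => rfl⟩
        refine ⟨c', ⟨by grind, by grind, ?_, ?_, fun j => ?_, by grind⟩, ?_⟩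
        · intro a j ha has
          have h1 : c' e = some i := by grind
          have h2 : c' f = some i := by grind
          by_cases haf : a = f
          · exact ⟨e, by grind⟩
          · obtain ⟨b', hb', hba⟩ := hpar a j (by grind) has
            by_cases hb'e : b' = e
            · exact ⟨f, by grind⟩
            · by_cases hb'b : b' = b
              · exact ⟨e, by grind⟩
              · exact ⟨b', by grind⟩
        · grind
        · by_cases hji : j = i
          · refine ⟨fun x => if x = v then 2 * k (D.tail e) + 1 else 2 * k x, ?_⟩
            have := hk e hce
            grind
          · obtain ⟨k', hk'⟩ := hrank j
            exact ⟨k', by grind⟩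
        · grind
    · obtain ⟨c', hc'⟩ : ∃ c' : E → Option E, ∀ a, c' a = if a = f then some i else c a :=
        ⟨_, fun _ => rfl⟩
      refine ⟨c', ⟨by grind, by grind, ?_, ?_, fun j => ?_, by grind⟩, ?_⟩
      · grind
      · grind
      · by_cases hji : j = i
        · obtain ⟨k, hk⟩ := hrank i
          refine ⟨fun x => if x = v then 2 * k (D.tail e) + 1 else 2 * k x, ?_⟩
          have := hk e hce
          grind
        · obtain ⟨k', hk'⟩ := hrank j
          exact ⟨k', by grind⟩
      · grind

end IsPacking
end Dgraph

namespace Dgraph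
namespace IsNet

variable {V E : Type} [DecidableEq V] [DecidableEq E] {D : Dgraph V E} {A M : Finset E} {s z : V}
  {S : Finset V} {r : V → ℕ}

theorem exists_isPacking_of_empty (h : D.IsNet A M s z ∅ r) :
    ∃ c, D.IsPacking A M s z c ∧ r z ≤ (D.covering A c z).card := by
  have hc : ∀ a e, (if a ∈ A ∧ a ∉ M then some a else none) = some e → a ∈ A ∧ a ∉ M ∧ e = a := by
    grind
  have ht : ∀ a ∈ A, D.tail a = s := fun a ha => by simpa using h.tail_mem a ha
  have hh : ∀ a ∈ A, D.head a = z := fun a ha => by simpa using h.head_mem a ha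
  have hsz := h.s_ne_z
  refine ⟨fun a => if a ∈ A ∧ a ∉ M then some a else none,
    ⟨by grind, by grind, by grind, by grind, fun e => ⟨fun x => if x = z then 1 else 0, by grind⟩,
      by grind⟩,
    (h.cut {z} (by simp) z (by simp) (by simp)).trans (Finset.card_le_card fun a ha => ?_)⟩
  simp only [Finset.mem_filter, Finset.mem_singleton, true_imp_iff] at ha
  exact mem_covering.2 ⟨ha.1, a, by simp [ha.1, ha.2.2.2], hh a ha.1⟩

theorem erase_loop (h : D.IsNet A M s z S r) {a : E} (ha : a ∈ A) (hloop : D.tail a = D.head a) :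
    D.IsNet (A.erase a) M s z S r := by
  refine ⟨h.s_notMem, h.z_notMem, h.s_ne_z, fun b hb => h.tail_mem b (Finset.mem_of_mem_erase hb),
    fun b hb => h.head_mem b (Finset.mem_of_mem_erase hb),
    fun b hb => h.tail_of_mem b (Finset.mem_of_mem_erase hb), fun v hv => ?_,
    fun X hX x hx hxz => (h.cut X hX x hx hxz).trans (Finset.card_le_card fun b hb => ?_)⟩
  · have := h.preflow v hv
    rw [Finset.filter_erase, Finset.filter_erase]
    by_cases hav : D.head a = v
    · rw [Finset.card_erase_of_mem (by simp [*]), Finset.card_erase_of_mem (by simp [*])]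
      omega
    · rwa [Finset.erase_eq_of_notMem (by simp [*]), Finset.erase_eq_of_notMem (by simp [*])]
  · simp only [Finset.mem_filter, Finset.mem_erase] at hb ⊢
    grind

theorem update_zero (h : D.IsNet A M s z S r) (v : V) :
    D.IsNet A M s z S (Function.update r v 0) := by
  refine ⟨h.s_notMem, h.z_notMem, h.s_ne_z, h.tail_mem, h.head_mem, h.tail_of_mem, h.preflow,
    fun X hX x hx hxz => ?_⟩
  rcases eq_or_ne x v with rfl | hxv
  · simp
  · rw [Function.update_of_ne hxv]
    exact h.cut X hX x hx hxz

theorem erase_sink (h : D.IsNet A M s z S r) {v : V} (hv : v ∈ S)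
    (hout : ∀ a ∈ A, D.tail a ≠ v) :
    D.IsNet (A.filter fun a => D.head a ≠ v) M s z (S.erase v) r := by
  have hvz : v ≠ z := fun h' => h.z_notMem (h' ▸ hv)
  refine ⟨fun hs => h.s_notMem (Finset.mem_of_mem_erase hs),
    fun hs => h.z_notMem (Finset.mem_of_mem_erase hs), h.s_ne_z, fun b hb => ?_,
    fun b hb => ?_, fun b hb => h.tail_of_mem b (Finset.mem_filter.1 hb).1, fun u hu => ?_,
    fun X hX x hx hxz => (h.cut X (fun y hy => ?_) x hx hxz).trans
      (Finset.card_le_card fun b hb => ?_)⟩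
  · have := h.tail_mem b
    grind
  · have := h.head_mem b
    grind
  · refine (Finset.card_le_card ?_).trans ((h.preflow u (Finset.mem_of_mem_erase hu)).trans
      (Finset.card_le_card ?_)) <;> grind
  · have := hX hy
    grind
  · have hvX : v ∉ X := fun hvX => by
      have := hX hvX
      grind
    simp only [Finset.mem_filter] at hb ⊢
    grind

theorem exists_isPacking_of_update (h : D.IsNet A M s z S r) {v : V} (hv : v ∈ S)
    (hmin : ∀ u ∈ S, r v ≤ r u) {c : E → Option E} (hc : D.IsPacking A M s z c)
    (hcov : ∀ x ∈ insert z S, x ≠ v → r x ≤ (D.covering A c x).card) :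
    ∃ c, D.IsPacking A M s z c ∧ ∀ x ∈ insert z S, r x ≤ (D.covering A c x).card := by
  have key : ∀ n ≤ r v, ∃ c, D.IsPacking A M s z c ∧ n ≤ (D.covering A c v).card ∧
      ∀ x ∈ insert z S, x ≠ v → r x ≤ (D.covering A c x).card := by
    intro n
    induction n with
    | zero => exact fun _ => ⟨c, hc, Nat.zero_le _, hcov⟩
    | succ n ih =>
      intro hn
      obtain ⟨c, hc, hcv, hcx⟩ := ih (by omega)
      rcases hcv.lt_or_eq with hlt | heq
      · exact ⟨c, hc, hlt, hcx⟩
      have hvz : z ∉ ({v} : Finset V) := fun h' => h.z_notMem (by grind)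
      have hcut := h.cut {v} (by simp [hv]) v (by simp) (fun h' => (hvz h').elim)
      obtain ⟨c', hc', hlt, hsub⟩ := hc.exists_covering_lt h hv (by omega) fun u hu huv => by
        have := hcx u (by simp [hu]) huv
        have := hmin u hu
        omega
      exact ⟨c', hc', by omega, fun x hx hxv => (hcx x hx hxv).trans
        (Finset.card_le_card (hsub x))⟩
  obtain ⟨c, hc, hcv, hcx⟩ := key _ le_rfl
  refine ⟨c, hc, fun x hx => ?_⟩
  by_cases hxv : x = v
  · rwa [hxv]
  · exact hcx x hx hxv

theorem exists_isPacking (h : D.IsNet A M s z S r) :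
    ∃ c, D.IsPacking A M s z c ∧ ∀ x ∈ insert z S, r x ≤ (D.covering A c x).card := by
  induction hn : S.card + A.card + ∑ u ∈ S, r u using Nat.strong_induction_on
    generalizing D A S r with
  | _ n ih =>
  rcases S.eq_empty_or_nonempty with rfl | hne
  · obtain ⟨c, hc, hcz⟩ := h.exists_isPacking_of_empty
    exact ⟨c, hc, by simpa using hcz⟩
  obtain ⟨v, hv, hmin⟩ := S.exists_min_image r hne
  have hvz : v ≠ z := fun h' => h.z_notMem (h' ▸ hv)
  have hvs : v ≠ s := fun h' => h.s_notMem (h' ▸ hv)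
  by_cases hloop : ∃ a ∈ A, D.tail a = D.head a
  · obtain ⟨a, ha, hal⟩ := hloop
    have := Finset.card_erase_lt_of_mem ha
    obtain ⟨c, hc, hcx⟩ := ih _ (by omega) (h.erase_loop ha hal) rfl
    have hsub := Finset.erase_subset a A
    exact ⟨c, hc.mono hsub, fun x hx => (hcx x hx).trans
      (Finset.card_le_card fun e he => mem_covering.2
        ⟨hsub (mem_covering.1 he).1, (mem_covering.1 he).2⟩)⟩
  push Not at hloop
  rcases Nat.eq_zero_or_pos (r v) with hrv | hrv
  · by_cases hout : ∃ f ∈ A, D.tail f = v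
    · obtain ⟨f, hf, hfv⟩ := hout
      obtain ⟨e, he, hev, hN⟩ := h.exists_moveHead hv hrv
        (fun a ha hav hav' => hloop a ha (hav.trans hav'.symm)) hf hfv
      have := Finset.card_erase_lt_of_mem hf
      obtain ⟨c, hc, hcx⟩ := ih _ (by omega) hN rfl
      obtain ⟨c', hc', hsub⟩ := hc.of_moveHead hf (fun h' => hloop e he (h'.trans hev.symm)) hvs
        hvz hev hfv rfl (fun h' => hloop f hf (hfv.trans h'.symm))
      refine ⟨c', hc', fun x hx => ?_⟩
      by_cases hxv : x = v
      · rw [hxv, hrv]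
        exact Nat.zero_le _
      · exact (hcx x hx).trans (Finset.card_le_card (hsub x hxv))
    · push Not at hout
      have h1 := Finset.card_erase_lt_of_mem hv
      have h2 := Finset.card_filter_le A fun a => D.head a ≠ v
      have h3 := Finset.sum_le_sum_of_subset (f := r) (Finset.erase_subset v S)
      obtain ⟨c, hc, hcx⟩ := ih _ (by omega) (h.erase_sink hv hout) rfl
      have hsub := Finset.filter_subset (fun a => D.head a ≠ v) A
      refine ⟨c, hc.mono hsub, fun x hx => ?_⟩
      by_cases hxv : x = v
      · rw [hxv, hrv]
        exact Nat.zero_le _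
      · exact (hcx x (by grind)).trans
          (Finset.card_le_card fun e he => mem_covering.2
            ⟨hsub (mem_covering.1 he).1, (mem_covering.1 he).2⟩)
  · have hsum : ∑ u ∈ S, Function.update r v 0 u < ∑ u ∈ S, r u := by
      refine Finset.sum_lt_sum (fun u _ => ?_) ⟨v, hv, by simpa using hrv⟩
      rcases eq_or_ne u v with rfl | huv
      · simp
      · rw [Function.update_of_ne huv]
    obtain ⟨c, hc, hcx⟩ := ih _ (by omega) (h.update_zero v) rfl
    refine h.exists_isPacking_of_update hv hmin hc fun x hx hxv => ?_
    have := hcx x hx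
    rwa [Function.update_of_ne hxv] at this

end IsNet
end Dgraph

namespace Dgraph

variable {Vt At : Type} {D : Dgraph Vt At} {τ : At → ℕ} {s : Vt}

theorem WalkFrom.append {u v w : Vt} {p q : List At} (hp : D.WalkFrom u p v)
    (hq : D.WalkFrom v q w) : D.WalkFrom u (p ++ q) w := by
  induction p generalizing u with
  | nil =>
    cases hp
    exact hq
  | cons a p ih => exact ⟨hp.1, ih hp.2⟩

theorem Reaches.refl (v : Vt) : D.Reaches v v := ⟨[], rfl⟩

theorem Reaches.trans {u v w : Vt} (h : D.Reaches u v) (h' : D.Reaches v w) : D.Reaches u w := by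
  obtain ⟨p, hp⟩ := h
  obtain ⟨q, hq⟩ := h'
  exact ⟨p ++ q, hp.append hq⟩

theorem reaches_arc (a : At) : D.Reaches (D.tail a) (D.head a) := ⟨[a], rfl, rfl⟩

/-- A walk entering `X` from outside uses an arc entering `X`. -/
theorem WalkFrom.exists_entering {X : Set Vt} {u x : Vt} {p : List At} (hp : D.WalkFrom u p x)
    (hu : u ∉ X) (hx : x ∈ X) :
    ∃ q a q', p = q ++ a :: q' ∧ D.tail a ∉ X ∧ D.head a ∈ X ∧ D.WalkFrom (D.head a) q' x := by
  induction p generalizing u with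
  | nil =>
    cases hp
    exact (hu hx).elim
  | cons a p ih =>
    obtain ⟨rfl, hp⟩ := hp
    by_cases ha : D.head a ∈ X
    · exact ⟨[], a, p, rfl, hu, ha, hp⟩
    · obtain ⟨q, b, q', rfl, h⟩ := ih hp ha
      exact ⟨a :: q, b, q', rfl, h⟩

variable [DecidableEq Vt] [Fintype At]

/-- The number of disjoint temporal paths is at most the size of any set of arcs meeting all of
them. -/
theorem lambdaT_le_card {v : Vt} {T : Finset At}
    (hT : ∀ p, D.IsPath s p v → Respects τ p → ∃ a ∈ p, a ∈ T) : D.lambdaT τ s v ≤ T.card := by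
  refine csSup_le ⟨0, fun i => i.elim0, fun i => i.elim0, fun i => i.elim0⟩ ?_
  rintro k ⟨P, hP, hdisj⟩
  choose g hgP hgT using fun i => hT (P i) (hP i).1 (hP i).2
  have hinj : Function.Injective g := fun i j hij => by
    by_contra hne
    exact hdisj i j hne _ (hgP i) (hij ▸ hgP j)
  simpa using Finset.card_le_card_of_injOn (s := Finset.univ) g (fun i _ => hgT i) hinj.injOn

/-- In a pre-flow temporal network the arcs leaving non-root vertices can be matched injectively
to arcs that may precede them. -/
theorem Preflow.exists_preceding (hpre : D.Preflow τ s) :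
    ∃ μ : At → At, (∀ f, D.tail f ≠ s → D.head (μ f) = D.tail f ∧ τ (μ f) ≤ τ f) ∧
      ∀ f g, D.tail f ≠ s → D.tail g ≠ s → μ f = μ g → f = g := by
  classical
  let T : {f : At // D.tail f ≠ s} → Finset At := fun f =>
    Finset.univ.filter fun a => D.head a = D.tail f ∧ τ a ≤ τ f
  have hall : ∀ F : Finset {f : At // D.tail f ≠ s}, F.card ≤ (F.biUnion T).card := by
    intro F
    have hmaps : ∀ f ∈ F, D.tail f.1 ∈ F.image fun f => D.tail f.1 := fun f hf =>
      Finset.mem_image_of_mem _ hf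
    have hmaps' : ∀ a ∈ F.biUnion T, D.head a ∈ F.image fun f => D.tail f.1 := fun a ha => by
      obtain ⟨f, hf, ha⟩ := Finset.mem_biUnion.1 ha
      rw [(Finset.mem_filter.1 ha).2.1]
      exact hmaps f hf
    rw [Finset.card_eq_sum_card_fiberwise hmaps, Finset.card_eq_sum_card_fiberwise hmaps']
    refine Finset.sum_le_sum fun v hv => ?_
    obtain ⟨f₀, hf₀, hf₀v⟩ := Finset.mem_image.1 hv
    obtain ⟨f, hf, hmax⟩ := (F.filter fun f => D.tail f.1 = v).exists_max_image (fun f => τ f.1)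
      ⟨f₀, by simp [hf₀, hf₀v]⟩
    obtain ⟨hfF, hfv⟩ := Finset.mem_filter.1 hf
    calc (F.filter fun f => D.tail f.1 = v).card ≤ (D.deltaLe τ v (τ f.1)).card :=
          Finset.card_le_card_of_injOn Subtype.val (fun g hg => by
            have := hmax g hg
            simp only [deltaLe, Finset.coe_filter, Set.mem_ofPred_eq] at hg ⊢
            exact ⟨Finset.mem_univ _, hg.2, this⟩) Subtype.val_injective.injOn
      _ ≤ (D.rhoLe τ v (τ f.1)).card := hpre _ _ (hfv ▸ f.2)
      _ ≤ _ := Finset.card_le_card fun a ha => by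
          simp only [rhoLe, Finset.mem_filter, Finset.mem_univ, true_and] at ha
          exact Finset.mem_filter.2 ⟨Finset.mem_biUnion.2
            ⟨f, hfF, by simp [T, ha.1, ha.2, hfv]⟩, ha.1⟩
  obtain ⟨μ, hinj, hμ⟩ := (Finset.all_card_le_biUnion_card_iff_exists_injective T).1 hall
  refine ⟨fun f => if hf : D.tail f ≠ s then μ ⟨f, hf⟩ else f, fun f hf => ?_,
    fun f g hf hg hfg => ?_⟩
  · simpa [T, hf] using hμ ⟨f, hf⟩
  · simp only [hf, hg, ne_eq, not_false_eq_true, dif_pos] at hfg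
    exact congrArg Subtype.val (hinj hfg)

end Dgraph

namespace Dgraph

section Layer

variable {Vt At : Type} [Fintype At] [DecidableEq Vt] [DecidableEq At]

/-- `C` is a strong component all of whose arcs have label `t`, the predecessors of `C` lie in the
predecessor-closed set `W`, and `μ` matches each arc to an arc that may precede it. -/
structure IsLayer (D : Dgraph Vt At) (τ : At → ℕ) (s : Vt) (W C : Finset Vt) (t : ℕ)
    (μ : At → At) : Prop where
  root_mem : s ∈ W
  disj : ∀ v ∈ C, v ∉ W
  pred : ∀ a, D.head a ∈ W → D.tail a ∈ W
  tail_mem : ∀ a, D.head a ∈ C → D.tail a ∈ W ∨ D.tail a ∈ C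
  inner : ∀ a, D.tail a ∈ C → D.head a ∈ C → τ a = t
  convex : ∀ a y, D.tail a ∈ C → y ∈ C → D.Reaches (D.head a) y → D.head a ∈ C
  head_match : ∀ f, D.tail f ≠ s → D.head (μ f) = D.tail f
  match_le : ∀ f, D.tail f ≠ s → τ (μ f) ≤ τ f
  match_inj : ∀ f g, D.tail f ≠ s → D.tail g ≠ s → μ f = μ g → f = g

/-- The arcs leaving the layer whose colour is determined inside the layer. -/
def regular (D : Dgraph Vt At) (τ : At → ℕ) (C : Finset Vt) (t : ℕ) (μ : At → At) : Finset At :=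
  Finset.univ.filter fun a => D.tail a ∈ C ∧ D.head a ∉ C ∧ t ≤ τ a ∧ τ (μ a) ≤ t

/-- The arcs of the static network of the layer. -/
def layerArcs (D : Dgraph Vt At) (τ : At → ℕ) (C : Finset Vt) (t : ℕ) (μ : At → At) : Finset At :=
  (Finset.univ.filter fun a => D.head a ∈ C ∧ τ a ≤ t) ∪ D.regular τ C t μ

/-- The arcs matched to arcs leaving the layer early. -/
def marked (D : Dgraph Vt At) (τ : At → ℕ) (C : Finset Vt) (t : ℕ) (μ : At → At) : Finset At :=
  (Finset.univ.filter fun a => D.tail a ∈ C ∧ D.head a ∉ C ∧ τ a < t).image μ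

/-- The arcs entering `x` that are too late to be used inside the layer. -/
def lateArcs (D : Dgraph Vt At) (τ : At → ℕ) (t : ℕ) (x : Vt) : Finset At :=
  Finset.univ.filter fun a => D.head a = x ∧ t < τ a

/-- The static network of the layer: `W` is contracted to `s`, and everything else outside of `C`
to `none`. -/
def contract (D : Dgraph Vt At) (s : Vt) (W C : Finset Vt) : Dgraph (Option Vt) At where
  tail a := if D.tail a ∈ W then some s else some (D.tail a)
  head a := if D.head a ∈ C then some (D.head a) else none

/-- The connectivity requirement in the static network of the layer. -/
noncomputable def requirement (D : Dgraph Vt At) (τ : At → ℕ) (s : Vt) (C : Finset Vt) (t : ℕ)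
    (μ : At → At) : Option Vt → ℕ
  | none => (D.regular τ C t μ).card
  | some x => D.lambdaT τ s x - (D.lateArcs τ t x).card

variable {D : Dgraph Vt At} {τ : At → ℕ} {s : Vt} {W C : Finset Vt} {t : ℕ} {μ : At → At}

theorem mem_regular {a : At} : a ∈ D.regular τ C t μ ↔
    D.tail a ∈ C ∧ D.head a ∉ C ∧ t ≤ τ a ∧ τ (μ a) ≤ t := by
  simp [regular]

theorem mem_layerArcs {a : At} : a ∈ D.layerArcs τ C t μ ↔
    (D.head a ∈ C ∧ τ a ≤ t) ∨ a ∈ D.regular τ C t μ := by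
  simp [layerArcs]

theorem mem_marked {a : At} : a ∈ D.marked τ C t μ ↔
    ∃ f, (D.tail f ∈ C ∧ D.head f ∉ C ∧ τ f < t) ∧ μ f = a := by
  simp [marked]

theorem mem_lateArcs {a : At} {x : Vt} : a ∈ D.lateArcs τ t x ↔ D.head a = x ∧ t < τ a := by
  simp [lateArcs]

namespace IsLayer

theorem ne_root (h : D.IsLayer τ s W C t μ) {v : Vt} (hv : v ∈ C) : v ≠ s := fun h' =>
  h.disj v hv (h' ▸ h.root_mem)

theorem marked_spec (h : D.IsLayer τ s W C t μ) {a : At} (ha : a ∈ D.marked τ C t μ) :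
    D.head a ∈ C ∧ τ a < t ∧ D.tail a ∈ W := by
  obtain ⟨f, ⟨h1, h2, h3⟩, rfl⟩ := mem_marked.1 ha
  have hs := h.ne_root h1
  have hh := h.head_match f hs
  have hl := h.match_le f hs
  have hC : D.head (μ f) ∈ C := hh ▸ h1
  exact ⟨hC, by omega, (h.tail_mem _ hC).resolve_right fun ht => by
    have := h.inner _ ht hC
    omega⟩

/-- The matching maps arcs of the static network with tail in `C` to unmarked arcs of it. -/
theorem match_mem (h : D.IsLayer τ s W C t μ) {a : At} (ha : a ∈ D.layerArcs τ C t μ)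
    (hC : D.tail a ∈ C) : D.head (μ a) = D.tail a ∧ τ (μ a) ≤ t ∧ μ a ∉ D.marked τ C t μ := by
  have hs := h.ne_root hC
  have hl := h.match_le a hs
  rw [mem_layerArcs, mem_regular] at ha
  refine ⟨h.head_match a hs, ?_, fun hm => ?_⟩
  · have := h.inner a hC
    grind
  · obtain ⟨f, ⟨h1, h2, h3⟩, h4⟩ := mem_marked.1 hm
    rw [h.match_inj f a (h.ne_root h1) hs h4] at h2 h3
    grind

theorem lambdaT_le (h : D.IsLayer τ s W C t μ) {X : Finset Vt} (hX : X ⊆ C) {x : Vt} (hx : x ∈ X) :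
    D.lambdaT τ s x ≤ (Finset.univ.filter fun a => D.tail a ∉ X ∧ D.head a ∈ X ∧ τ a ≤ t).card +
      (D.lateArcs τ t x).card := by
  refine le_trans (lambdaT_le_card fun p hp hτ => ?_) (Finset.card_union_le _ _)
  have hsX : s ∉ (X : Set Vt) := fun h' => h.disj s (hX h') h.root_mem
  obtain ⟨q, a, q', rfl, hat, hah, hq'⟩ := hp.1.exists_entering hsX (Finset.mem_coe.2 hx)
  refine ⟨a, by simp, ?_⟩
  simp only [Finset.mem_union, Finset.mem_filter, Finset.mem_univ, true_and, mem_lateArcs]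
  rcases le_or_gt (τ a) t with ht | ht
  · exact Or.inl ⟨hat, hah, ht⟩
  · right
    refine ⟨?_, ht⟩
    cases q' with
    | nil => exact hq'
    | cons b q' =>
      have hbt : D.tail b ∈ C := hq'.1 ▸ hX hah
      have := h.inner b hbt (h.convex b x hbt (hX hx) ⟨q', hq'.2⟩)
      have hab : τ a ≤ τ b := by
        unfold Respects at hτ
        rw [List.map_append, List.map_cons, List.map_cons] at hτ
        have h2 := (List.isChain_append.1 hτ).2.1
        exact (List.isChain_cons_cons.1 h2).1
      omega

theorem card_regular_le (h : D.IsLayer τ s W C t μ) {Y : Finset Vt} (hY : Y ⊆ C) :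
    (D.regular τ C t μ).card ≤ ((D.layerArcs τ C t μ).filter fun a =>
      D.tail a ∉ Y ∧ (D.head a ∈ C → D.head a ∈ Y) ∧ a ∉ D.marked τ C t μ).card := by
  have hmatch : ((D.layerArcs τ C t μ).filter fun a => D.tail a ∈ Y).card ≤
      ((D.layerArcs τ C t μ).filter fun a => D.head a ∈ Y ∧ a ∉ D.marked τ C t μ).card := by
    refine Finset.card_le_card_of_injOn μ (fun a ha => ?_) fun a ha b hb hab => ?_
    · simp only [Finset.coe_filter, Set.mem_ofPred_eq] at ha ⊢
      obtain ⟨h1, h2, h3⟩ := h.match_mem ha.1 (hY ha.2)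
      exact ⟨mem_layerArcs.2 (Or.inl ⟨h1 ▸ hY ha.2, h2⟩), h1 ▸ ha.2, h3⟩
    · simp only [Finset.coe_filter, Set.mem_ofPred_eq] at ha hb
      exact h.match_inj a b (h.ne_root (hY ha.2)) (h.ne_root (hY hb.2)) hab
  have hsum : (D.regular τ C t μ).card +
      ((D.layerArcs τ C t μ).filter fun a => D.head a ∈ Y ∧ a ∉ D.marked τ C t μ).card ≤
      ((D.layerArcs τ C t μ).filter fun a => D.tail a ∈ Y).card +
      ((D.layerArcs τ C t μ).filter fun a =>
        D.tail a ∉ Y ∧ (D.head a ∈ C → D.head a ∈ Y) ∧ a ∉ D.marked τ C t μ).card := by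
    have hreg : D.regular τ C t μ =
        (D.layerArcs τ C t μ).filter fun a => a ∈ D.regular τ C t μ := by
      ext a
      simp only [Finset.mem_filter, mem_layerArcs]
      tauto
    rw [hreg]
    simp only [Finset.card_filter, ← Finset.sum_add_distrib]
    refine Finset.sum_le_sum fun a ha => ?_
    have h1 : a ∈ D.regular τ C t μ → D.head a ∉ C := fun h' => (mem_regular.1 h').2.1
    have h2 : a ∈ D.marked τ C t μ → D.head a ∈ C := fun h' => (h.marked_spec h').1
    have h3 := @hY (D.head a)
    clear hreg hmatch
    by_cases h4 : a ∈ D.regular τ C t μ <;> by_cases h5 : D.head a ∈ Y <;>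
      by_cases h6 : D.tail a ∈ Y <;> by_cases h7 : a ∈ D.marked τ C t μ <;> simp_all
  omega

theorem contract_tail_mem_image (h : D.IsLayer τ s W C t μ) {X : Finset (Option Vt)}
    (hX : X ⊆ insert none (C.image some)) (a : At) :
    (D.contract s W C).tail a ∈ X ↔ some (D.tail a) ∈ X := by
  have key : ∀ v ∈ W, some v ∉ X := fun v hv hvX => by
    have := hX hvX
    simp only [Finset.mem_insert, reduceCtorEq, Finset.mem_image, Option.some.injEq,
      exists_eq_right, false_or] at this
    exact h.disj v this hv
  have h1 := key s h.root_mem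
  have h2 := key (D.tail a)
  simp only [contract]
  split_ifs with ht <;> simp_all

theorem isNet (h : D.IsLayer τ s W C t μ) :
    (D.contract s W C).IsNet (D.layerArcs τ C t μ) (D.marked τ C t μ) (some s) none (C.image some)
      (D.requirement τ s C t μ) := by
  have htail : ∀ a ∈ D.layerArcs τ C t μ, D.tail a ∈ W ∨ D.tail a ∈ C := fun a ha => by
    rcases mem_layerArcs.1 ha with ha | ha
    exacts [h.tail_mem a ha.1, Or.inr (mem_regular.1 ha).1]
  refine ⟨?_, by simp, by simp, fun a ha => ?_, fun a ha => ?_, fun a ha haM => ?_,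
    fun v hv => ?_, fun X hX x hx hxz => ?_⟩
  · simpa using fun h' => h.ne_root h' rfl
  · have := htail a ha
    simp only [contract]
    split_ifs with hW <;> simp_all
  · simp only [contract]
    split_ifs with hW <;> simp_all
  · simp [contract, (h.marked_spec haM).2.2]
  · obtain ⟨v, hvC, rfl⟩ : ∃ u ∈ C, some u = v := by simpa using hv
    have hts : ∀ a, (D.contract s W C).tail a = some v ↔ D.tail a = v := fun a => by
      have h1 := h.ne_root hvC
      have h2 := h.disj v hvC
      simp only [contract]
      grind
    refine Finset.card_le_card_of_injOn μ (fun a ha => ?_) fun a ha b hb hab => ?_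
    · simp only [Finset.coe_filter, Set.mem_ofPred_eq, hts] at ha ⊢
      obtain ⟨haA, rfl⟩ := ha
      obtain ⟨h1, h2, h3⟩ := h.match_mem haA hvC
      exact ⟨mem_layerArcs.2 (Or.inl ⟨h1 ▸ hvC, h2⟩), by simp [contract, h1, hvC]⟩
    · simp only [Finset.coe_filter, Set.mem_ofPred_eq, hts] at ha hb
      exact h.match_inj a b (ha.2 ▸ h.ne_root hvC) (hb.2 ▸ h.ne_root hvC) hab
  · have hXC : ∀ v, some v ∈ X → v ∈ C := fun v hv => by simpa using hX hv
    let Y := C.filter fun v => some v ∈ X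
    have hY : ∀ v, v ∈ Y ↔ some v ∈ X := fun v => by
      simp only [Y, Finset.mem_filter, and_iff_right_iff_imp]
      exact hXC v
    have hYC : Y ⊆ C := Finset.filter_subset _ C
    simp only [cutIn, h.contract_tail_mem_image hX, ← hY]
    cases x with
    | none =>
      refine (h.card_regular_le hYC).trans (Finset.card_le_card fun a ha => ?_)
      simp only [Finset.mem_filter] at ha ⊢
      refine ⟨ha.1, ha.2.1, ?_, fun _ => ha.2.2.2⟩
      simp only [contract]
      split_ifs with hC
      · exact (hY _).1 (ha.2.2.1 hC)
      · exact hx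
    | some x =>
      have hz : none ∉ X := fun h' => by cases hxz h'
      have := h.lambdaT_le hYC ((hY x).2 hx)
      refine Nat.sub_le_iff_le_add.2 (this.trans (Nat.add_le_add_right
        (Finset.card_le_card fun a ha => ?_) _))
      simp only [Finset.mem_filter, Finset.mem_univ, true_and] at ha ⊢
      refine ⟨mem_layerArcs.2 (Or.inl ⟨hYC ha.2.1, ha.2.2⟩), ha.1, ?_, fun h' => (hz h').elim⟩
      simp only [contract, hYC ha.2.1, if_true]
      exact (hY _).1 ha.2.1

end IsLayer

end Layer
end Dgraph

namespace Dgraph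

section Extend

variable {Vt At : Type} [Fintype At] [DecidableEq Vt]

/-- A partial colouring of the arcs with tail in the predecessor-closed set `W` by root arcs, whose
colour classes restricted to `W` are `τ`-respecting `s`-arborescences covering each `v ∈ W` at least
`λ(s, v)` times, and in which the arcs leaving `W` have distinct colours. -/
structure IsTPacking (D : Dgraph Vt At) (τ : At → ℕ) (s : Vt) (W : Finset Vt)
    (c : At → Option At) : Prop where
  root_mem : s ∈ W
  pred : ∀ a, D.head a ∈ W → D.tail a ∈ W
  mem : ∀ a e, c a = some e → D.tail e = s ∧ D.tail a ∈ W
  root : ∀ a e, c a = some e → D.tail a = s → e = a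
  parent : ∀ a e, c a = some e → D.tail a ≠ s →
    ∃ b, c b = some e ∧ D.head b = D.tail a ∧ τ b ≤ τ a
  unique : ∀ a b e, c a = some e → c b = some e → D.head a ∈ W → D.head a = D.head b → a = b
  leaving : ∀ a, D.tail a ∈ W → D.head a ∉ W → ∃ e, c a = some e
  leaving_inj : ∀ a b e, D.head a ∉ W → D.head b ∉ W → c a = some e → c b = some e → a = b
  rank : ∀ e, ∃ h : Vt → ℕ, ∀ a, c a = some e → D.head a ∈ W → h (D.tail a) < h (D.head a)
  cover : ∀ v ∈ W, v ≠ s → ∃ F : Finset At, D.lambdaT τ s v ≤ F.card ∧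
    ∀ e ∈ F, ∃ a, c a = some e ∧ D.head a = v

open Classical in
/-- The arc (if any) whose colour an arc inherits when a colouring is extended over the layer `C`,
given the colouring `c` of the static network of the layer. -/
noncomputable def source (D : Dgraph Vt At) (τ : At → ℕ) (W C : Finset Vt) (t : ℕ)
    (μ : At → At) (c : At → Option At) (a : At) : Option At :=
  if D.tail a ∈ W then some a
  else if D.tail a ∈ C then
    if D.head a ∈ C ∨ a ∈ D.regular τ C t μ then c a else some (μ a)
  else none

variable [DecidableEq At]
variable {D : Dgraph Vt At} {τ : At → ℕ} {s : Vt} {W C : Finset Vt} {t : ℕ} {μ : At → At}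
  {c k : At → Option At}

theorem exists_color_of_regular
    (hk : (D.contract s W C).IsPacking (D.layerArcs τ C t μ) (D.marked τ C t μ) (some s) none k)
    (hcov : (D.regular τ C t μ).card ≤
      ((D.contract s W C).covering (D.layerArcs τ C t μ) k none).card) {a : At}
    (ha : a ∈ D.regular τ C t μ) : ∃ e, k a = some e := by
  by_contra hcon
  have hex : ∀ e ∈ (D.contract s W C).covering (D.layerArcs τ C t μ) k none,
      ∃ b, k b = some e ∧ (D.contract s W C).head b = none := fun e he => (mem_covering.1 he).2
  choose! g hg hgh using hex
  have := Finset.card_le_card_of_injOn (t := (D.regular τ C t μ).erase a) g (fun e he => by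
    have h1 := hg e he
    have h2 := hgh e he
    have h3 := mem_layerArcs.1 (hk.mem _ _ h1).1
    simp only [contract, ite_eq_right_iff, reduceCtorEq, imp_false] at h2
    refine Finset.mem_coe.2 (Finset.mem_erase.2 ⟨fun h' => hcon ⟨e, h' ▸ h1⟩,
      h3.resolve_left fun h' => h2 h'.1⟩)) fun e he e' he' hee => by
    have h1 := hg e he
    rw [hee, hg e' he'] at h1
    exact (Option.some.inj h1).symm
  have := Finset.card_erase_lt_of_mem ha
  omega

namespace IsLayer

theorem match_spec_of_not_regular (h : D.IsLayer τ s W C t μ) {a : At} (hC : D.tail a ∈ C)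
    (hh : D.head a ∉ C) (hr : a ∉ D.regular τ C t μ) :
    D.head (μ a) = D.tail a ∧ τ (μ a) ≤ τ a ∧ D.tail (μ a) ∈ W ∧
      (μ a ∈ D.marked τ C t μ ∨ t < τ (μ a)) := by
  have hs := h.ne_root hC
  have h1 := h.head_match a hs
  rw [mem_regular] at hr
  have key : μ a ∈ D.marked τ C t μ ∨ t < τ (μ a) := by
    by_cases hat : τ a < t
    · exact Or.inl (mem_marked.2 ⟨a, ⟨hC, hh, hat⟩, rfl⟩)
    · grind
  refine ⟨h1, h.match_le a hs, ?_, key⟩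
  rcases key with hm | ht
  · exact (h.marked_spec hm).2.2
  · exact (h.tail_mem _ (h1 ▸ hC)).resolve_right fun h' => by
      have := h.inner _ h' (h1 ▸ hC)
      omega

theorem static_spec (h : D.IsLayer τ s W C t μ)
    (hk : (D.contract s W C).IsPacking (D.layerArcs τ C t μ) (D.marked τ C t μ) (some s) none k)
    {a e : At} (ha : k a = some e) : D.tail e ∈ W ∧ D.head e ∈ C ∧ τ e ≤ t := by
  obtain ⟨-, h1, h2⟩ := hk.mem a e ha
  have hW : D.tail e ∈ W := by
    by_contra hW
    simp only [contract, hW, if_false, Option.some.injEq] at h2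
    exact hW (h2 ▸ h.root_mem)
  rcases mem_layerArcs.1 h1 with h3 | h3
  · exact ⟨hW, h3⟩
  · exact (h.disj _ (mem_regular.1 h3).1 hW).elim

/-- A source is an arc leaving `W`, unless it stays in `W`. -/
theorem source_spec (h : D.IsLayer τ s W C t μ)
    (hk : (D.contract s W C).IsPacking (D.layerArcs τ C t μ) (D.marked τ C t μ) (some s) none k)
    {a e : At} (ha : D.source τ W C t μ k a = some e) :
    (D.tail a ∈ W ∧ e = a) ∨ (D.tail a ∈ C ∧ D.tail a ∉ W ∧ D.tail e ∈ W ∧ D.head e ∈ C ∧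
      (((D.head a ∈ C ∨ a ∈ D.regular τ C t μ) ∧ k a = some e) ∨
        (D.head a ∉ C ∧ a ∉ D.regular τ C t μ ∧ e = μ a))) := by
  unfold source at ha
  split_ifs at ha with h1 h2 h3
  · exact Or.inl ⟨h1, (Option.some.inj ha).symm⟩
  · obtain ⟨h4, h5, -⟩ := h.static_spec hk ha
    exact Or.inr ⟨h2, h1, h4, h5, Or.inl ⟨h3, ha⟩⟩
  · rw [not_or] at h3
    obtain ⟨h4, -, h5, -⟩ := h.match_spec_of_not_regular h2 h3.1 h3.2
    cases ha
    exact Or.inr ⟨h2, h1, h5, h4 ▸ h2, Or.inr ⟨h3.1, h3.2, rfl⟩⟩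

theorem source_unique (h : D.IsLayer τ s W C t μ)
    (hk : (D.contract s W C).IsPacking (D.layerArcs τ C t μ) (D.marked τ C t μ) (some s) none k)
    {a b e : At} (ha : D.source τ W C t μ k a = some e) (hb : D.source τ W C t μ k b = some e)
    (hhC : D.head a ∈ C) (hab : D.head a = D.head b) : a = b := by
  have hhC' : D.head b ∈ C := hab ▸ hhC
  have huniq : ∀ a b, k a = some e → k b = some e → D.head a ∈ C → D.head a = D.head b → a = b :=
    fun a b ha hb _ hab => hk.unique a b e ha hb (by simp [contract, hab])
  rcases h.source_spec hk ha with ⟨h1, rfl⟩ | ⟨h1, h2, h3, h4, h5⟩ <;>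
    rcases h.source_spec hk hb with ⟨g1, g6⟩ | ⟨g1, g2, g3, g4, g5⟩
  · exact g6
  · rcases g5 with ⟨-, g5⟩ | ⟨g5, -⟩
    · exact huniq _ _ (hk.color_root g5) g5 hhC hab
    · exact (g5 hhC').elim
  · subst g6
    rcases h5 with ⟨-, h5⟩ | ⟨h5, -⟩
    · exact huniq _ _ h5 (hk.color_root h5) hhC hab
    · exact (h5 hhC).elim
  · rcases h5 with ⟨-, h5⟩ | ⟨h5, -⟩
    · rcases g5 with ⟨-, g5⟩ | ⟨g5, -⟩
      · exact huniq _ _ h5 g5 hhC hab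
      · exact (g5 hhC').elim
    · exact (h5 hhC).elim

theorem source_inj_leaving (h : D.IsLayer τ s W C t μ)
    (hk : (D.contract s W C).IsPacking (D.layerArcs τ C t μ) (D.marked τ C t μ) (some s) none k)
    {a b e : At} (ha : D.source τ W C t μ k a = some e) (hb : D.source τ W C t μ k b = some e)
    (haC : D.head a ∉ C) (hbC : D.head b ∉ C) : a = b := by
  have hmix : ∀ a b, k a = some e → D.head a ∉ C → D.tail b ∈ C → D.head b ∉ C →
      b ∉ D.regular τ C t μ → e ≠ μ b := by
    rintro a b ha haC hbC hbC' hbr rfl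
    obtain ⟨-, -, h3⟩ := h.static_spec hk ha
    rcases (h.match_spec_of_not_regular hbC hbC' hbr).2.2.2 with h4 | h4
    · exact hk.avoid a _ ha (by simp [contract, haC]) h4
    · omega
  rcases h.source_spec hk ha with ⟨h1, h6⟩ | ⟨h1, h2, h3, h4, h5⟩ <;>
    rcases h.source_spec hk hb with ⟨g1, g6⟩ | ⟨g1, g2, g3, g4, g5⟩
  · exact h6.symm.trans g6
  · exact (haC (h6 ▸ g4)).elim
  · exact (hbC (g6 ▸ h4)).elim
  · rcases h5 with ⟨-, h5⟩ | ⟨-, h6, h5⟩ <;> rcases g5 with ⟨-, g5⟩ | ⟨-, g6, g5⟩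
    · exact hk.unique a b e h5 g5 (by simp [contract, haC, hbC])
    · exact (hmix a b h5 haC g1 hbC g6 g5).elim
    · exact (hmix b a g5 hbC h1 haC h6 h5).elim
    · exact h.match_inj a b (h.ne_root h1) (h.ne_root g1) (h5.symm.trans g5)

/-- Arcs with the same source have a predecessor with that source. -/
theorem source_parent (h : D.IsLayer τ s W C t μ)
    (hk : (D.contract s W C).IsPacking (D.layerArcs τ C t μ) (D.marked τ C t μ) (some s) none k)
    {a e : At} (ha : D.source τ W C t μ k a = some e) (hC : D.tail a ∈ C) :
    ∃ b, D.source τ W C t μ k b = some e ∧ D.head b = D.tail a ∧ τ b ≤ τ a := by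
  rcases h.source_spec hk ha with ⟨h1, -⟩ | ⟨-, h2, h3, h4, ⟨h5, h6⟩ | ⟨h5, h6, h7⟩⟩
  · exact (h.disj _ hC h1).elim
  · have hs := h.ne_root hC
    obtain ⟨b, hb, hba⟩ := hk.parent a e h6 (by simp [contract, h2, hs])
    have hbC : D.head b ∈ C := by
      by_contra hbC
      simp only [contract, hbC, h2, if_false, reduceCtorEq] at hba
    simp only [contract, hbC, h2, if_true, if_false, Option.some.injEq] at hba
    have hbt : τ b ≤ t := by
      rcases mem_layerArcs.1 (hk.mem b e hb).1 with h' | h'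
      exacts [h'.2, ((mem_regular.1 h').2.1 hbC).elim]
    have hat : t ≤ τ a := by
      rcases h5 with h5 | h5
      exacts [(h.inner a hC h5).ge, (mem_regular.1 h5).2.2.1]
    refine ⟨b, ?_, hba, hbt.trans hat⟩
    by_cases hbW : D.tail b ∈ W
    · have := hk.root b e hb (by simp [contract, hbW])
      simp [source, hbW, this]
    · have := (h.tail_mem b hbC).resolve_left hbW
      simp [source, hbW, this, hbC, hb]
  · obtain ⟨g1, g2, g3, -⟩ := h.match_spec_of_not_regular hC h5 h6
    exact ⟨μ a, by simp [source, g3, h7], g1, g2⟩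

end IsLayer

end Extend
end Dgraph

namespace Dgraph

variable {Vt At : Type} [Fintype Vt] [Fintype At] [DecidableEq Vt] [DecidableEq At]
  {D : Dgraph Vt At} {τ : At → ℕ} {s : Vt} {W C : Finset Vt} {t : ℕ} {μ : At → At}
  {c : At → Option At}

/-- A colouring can be extended over a layer. -/
theorem IsTPacking.exists_union (hc : D.IsTPacking τ s W c) (h : D.IsLayer τ s W C t μ) :
    ∃ c', D.IsTPacking τ s (W ∪ C) c' := by
  obtain ⟨k, hk, hcov⟩ := h.isNet.exists_isPacking
  have hnew : ∀ a e, (D.source τ W C t μ k a).bind c = some e ↔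
      ∃ b, D.source τ W C t μ k a = some b ∧ c b = some e := fun a e => Option.bind_eq_some_iff
  have hold : ∀ a, D.tail a ∈ W → (D.source τ W C t μ k a).bind c = c a := fun a ha => by
    simp [source, ha]
  have hleave : ∀ a b, D.source τ W C t μ k a = some b → D.head a ∉ W → D.head b ∉ W :=
    fun a b hab ha => by
      rcases h.source_spec hk hab with ⟨-, rfl⟩ | ⟨-, -, -, h', -⟩
      exacts [ha, h.disj _ h']
  refine ⟨fun a => (D.source τ W C t μ k a).bind c, ⟨by simp [hc.root_mem], fun a ha => ?_,
    fun a e ha => ?_, fun a e ha has => ?_, fun a e ha has => ?_, fun a b e ha hb haW hab => ?_,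
    fun a ha haW => ?_, fun a b e haW hbW ha hb => ?_, fun e => ?_, fun v hv hvs => ?_⟩⟩
  · rw [Finset.mem_union] at ha ⊢
    rcases ha with ha | ha
    exacts [Or.inl (hc.pred a ha), h.tail_mem a ha]
  · obtain ⟨b, hab, hb⟩ := (hnew a e).1 ha
    refine ⟨(hc.mem b e hb).1, ?_⟩
    rw [Finset.mem_union]
    rcases h.source_spec hk hab with ⟨h', -⟩ | ⟨h', -⟩
    exacts [Or.inl h', Or.inr h']
  · rw [hold a (has ▸ h.root_mem)] at ha
    exact hc.root a e ha has
  · obtain ⟨a', haa, ha'⟩ := (hnew a e).1 ha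
    by_cases haW : D.tail a ∈ W
    · rw [hold a haW] at ha
      obtain ⟨b, hb, hba⟩ := hc.parent a e ha has
      exact ⟨b, (hold b (hc.mem b e hb).2).trans hb, hba⟩
    · have haC : D.tail a ∈ C := by
        rcases h.source_spec hk haa with ⟨h', -⟩ | ⟨h', -⟩
        exacts [(haW h').elim, h']
      obtain ⟨b, hb, hba⟩ := h.source_parent hk haa haC
      exact ⟨b, (hnew b e).2 ⟨a', hb, ha'⟩, hba⟩
  · by_cases haW' : D.head a ∈ W
    · rw [hold a (hc.pred a haW')] at ha
      rw [hold b (hc.pred b (hab ▸ haW'))] at hb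
      exact hc.unique a b e ha hb haW' hab
    · obtain ⟨a', haa, ha'⟩ := (hnew a e).1 ha
      obtain ⟨b', hbb, hb'⟩ := (hnew b e).1 hb
      cases hc.leaving_inj a' b' e (hleave _ _ haa haW') (hleave _ _ hbb (hab ▸ haW')) ha' hb'
      exact h.source_unique hk haa hbb ((Finset.mem_union.1 haW).resolve_left haW') hab
  · rw [Finset.mem_union, not_or] at haW
    obtain ⟨b, hb, hbW⟩ : ∃ b, D.source τ W C t μ k a = some b ∧ D.tail b ∈ W := by
      by_cases haW' : D.tail a ∈ W
      · exact ⟨a, by simp [source, haW'], haW'⟩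
      · have haC := (Finset.mem_union.1 ha).resolve_left haW'
        by_cases hr : a ∈ D.regular τ C t μ
        · obtain ⟨b, hb⟩ := exists_color_of_regular hk (hcov none (by simp)) hr
          exact ⟨b, by simp [source, haW', haC, hr, hb], (h.static_spec hk hb).1⟩
        · exact ⟨μ a, by simp [source, haW', haC, hr, haW.2],
            (h.match_spec_of_not_regular haC haW.2 hr).2.2.1⟩
    obtain ⟨e, he⟩ := hc.leaving b hbW (hleave a b hb haW.1)
    exact ⟨e, (hnew a e).2 ⟨b, hb, he⟩⟩
  · rw [Finset.mem_union, not_or] at haW hbW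
    obtain ⟨a', haa, ha'⟩ := (hnew a e).1 ha
    obtain ⟨b', hbb, hb'⟩ := (hnew b e).1 hb
    cases hc.leaving_inj a' b' e (hleave _ _ haa haW.1) (hleave _ _ hbb hbW.1) ha' hb'
    exact h.source_inj_leaving hk haa hbb haW.2 hbW.2
  · obtain ⟨g, hg⟩ := hc.rank e
    obtain ⟨l, hl⟩ : ∃ l : Option Vt → ℕ, ∀ a b, c b = some e → k a = some b →
        l ((D.contract s W C).tail a) < l ((D.contract s W C).head a) := by
      by_cases hex : ∃ b, c b = some e ∧ D.head b ∉ W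
      · obtain ⟨b, hb, hbW⟩ := hex
        obtain ⟨l, hl⟩ := hk.rank b
        refine ⟨l, fun a b' hb' ha => ?_⟩
        have := hc.leaving_inj b' b e (h.disj _ (h.static_spec hk ha).2.1) hbW hb' hb
        exact hl a (this ▸ ha)
      · exact ⟨0, fun a b hb ha =>
          (hex ⟨b, hb, h.disj _ (h.static_spec hk ha).2.1⟩).elim⟩
    refine ⟨fun x => if x ∈ C then 1 + ∑ y, g y + l (some x) else g x, fun a ha haW => ?_⟩
    obtain ⟨b, hab, hb⟩ := (hnew a e).1 ha
    have hle : g (D.tail a) ≤ ∑ y, g y :=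
      Finset.single_le_sum (fun _ _ => Nat.zero_le _) (Finset.mem_univ (D.tail a))
    rcases Finset.mem_union.1 haW with haW | haC
    · rw [hold a (hc.pred a haW)] at ha
      have h1 : D.head a ∉ C := fun h' => h.disj _ h' haW
      have h2 : D.tail a ∉ C := fun h' => h.disj _ h' (hc.pred a haW)
      simpa only [h1, h2, if_false] using hg a ha haW
    · by_cases htC : D.tail a ∈ C
      · rcases h.source_spec hk hab with ⟨h1, -⟩ | ⟨-, h2, -, -, ⟨-, h6⟩ | ⟨h5, -⟩⟩
        · exact (h.disj _ htC h1).elim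
        · have := hl a b hb h6
          simp only [contract, h2, haC, if_true, if_false] at this
          simp only [htC, haC, if_true]
          omega
        · exact (h5 haC).elim
      · simp only [htC, haC, if_true, if_false]
        omega
  · rcases Finset.mem_union.1 hv with hvW | hvC
    · obtain ⟨F, hF, hFc⟩ := hc.cover v hvW hvs
      refine ⟨F, hF, fun e he => ?_⟩
      obtain ⟨a, ha, hav⟩ := hFc e he
      exact ⟨a, (hold a (hc.mem a e ha).2).trans ha, hav⟩
    · have hreq := hcov (some v) (by simpa using hvC)
      simp only [requirement] at hreq
      let G := (D.contract s W C).covering (D.layerArcs τ C t μ) k (some v) ∪ D.lateArcs τ t v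
      have hG : ∀ b ∈ G, D.head b ∈ C ∧ D.tail b ∈ W ∧
          ∃ a, D.source τ W C t μ k a = some b ∧ D.head a = v := by
        intro b hb
        rcases Finset.mem_union.1 hb with hb | hb
        · obtain ⟨-, a, ha, hav⟩ := mem_covering.1 hb
          obtain ⟨h1, h2, -⟩ := h.static_spec hk ha
          have haC : D.head a ∈ C := by
            by_contra haC
            simp [contract, haC] at hav
          refine ⟨h2, h1, a, ?_, by simpa [contract, haC] using hav⟩
          by_cases haW : D.tail a ∈ W
          · have := hk.root a b ha (by simp [contract, haW])
            simp [source, haW, this]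
          · have := (h.tail_mem a haC).resolve_left haW
            simp [source, haW, this, haC, ha]
        · obtain ⟨rfl, hbt⟩ := mem_lateArcs.1 hb
          have hbW : D.tail b ∈ W := (h.tail_mem b hvC).resolve_right fun h' => by
            have := h.inner b h' hvC
            omega
          exact ⟨hvC, hbW, b, by simp [source, hbW], rfl⟩
      have hdisj : Disjoint ((D.contract s W C).covering (D.layerArcs τ C t μ) k (some v))
          (D.lateArcs τ t v) := by
        refine Finset.disjoint_left.2 fun b hb hb' => ?_
        obtain ⟨-, a, ha, -⟩ := mem_covering.1 hb
        have := (h.static_spec hk ha).2.2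
        have := (mem_lateArcs.1 hb').2
        omega
      have hcol : ∀ b ∈ G, ∃ e, c b = some e := fun b hb =>
        hc.leaving b (hG b hb).2.1 (h.disj _ (hG b hb).1)
      choose! g hg using hcol
      refine ⟨G.image g, ?_, fun e he => ?_⟩
      · rw [Finset.card_image_of_injOn fun b hb b' hb' hbb => hc.leaving_inj b b' (g b)
          (h.disj _ (hG b hb).1) (h.disj _ (hG b' hb').1) (hg b hb) ((hg b' hb').trans (congrArg some hbb.symm)),
          Finset.card_union_of_disjoint hdisj]
        omega
      · obtain ⟨b, hb, rfl⟩ := Finset.mem_image.1 he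
        obtain ⟨-, -, a, ha, hav⟩ := hG b hb
        exact ⟨a, (hnew a _).2 ⟨b, ha, hg b hb⟩, hav⟩

end Dgraph

namespace Dgraph

variable {Vt At : Type} [Fintype Vt] [Fintype At] [DecidableEq Vt] [DecidableEq At]
  {D : Dgraph Vt At} {τ : At → ℕ} {s : Vt} {W : Finset Vt} {c : At → Option At}

theorem exists_isLayer (hcons : D.Consistent τ) {μ : At → At}
    (hμ : ∀ f, D.tail f ≠ s → D.head (μ f) = D.tail f ∧ τ (μ f) ≤ τ f)
    (hinj : ∀ f g, D.tail f ≠ s → D.tail g ≠ s → μ f = μ g → f = g) (hs : s ∈ W)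
    (hW : ∀ a, D.head a ∈ W → D.tail a ∈ W) (hne : W ≠ Finset.univ) :
    ∃ C t, (∃ v ∈ C, v ∉ W) ∧ D.IsLayer τ s W C t μ := by
  classical
  obtain ⟨v, hvW, hmin⟩ := Wᶜ.exists_min_image
    (fun v => (Finset.univ.filter fun u => D.Reaches u v).card)
    (by rwa [Finset.nonempty_iff_ne_empty, Ne, Finset.compl_eq_empty_iff])
  rw [Finset.mem_compl] at hvW
  have hWr : ∀ p u w, D.WalkFrom u p w → w ∈ W → u ∈ W := by
    intro p
    induction p with
    | nil =>
      rintro u w rfl hw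
      exact hw
    | cons a p ih =>
      rintro u w ⟨rfl, hp⟩ hw
      exact hW a (ih _ _ hp hw)
  let C := Finset.univ.filter fun u => D.MutuallyReachable u v
  have hC : ∀ u, u ∈ C ↔ D.Reaches u v ∧ D.Reaches v u := fun u =>
    Finset.mem_filter.trans (and_iff_right (Finset.mem_univ u))
  have hmut : ∀ x y, x ∈ C → y ∈ C → D.MutuallyReachable x y := fun x y hx hy =>
    ⟨((hC x).1 hx).1.trans ((hC y).1 hy).2, ((hC y).1 hy).1.trans ((hC x).1 hx).2⟩
  obtain ⟨t, ht⟩ : ∃ t, ∀ a, D.tail a ∈ C → D.head a ∈ C → τ a = t := by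
    by_cases hex : ∃ a, D.tail a ∈ C ∧ D.head a ∈ C
    · obtain ⟨a, ha, ha'⟩ := hex
      exact ⟨τ a, fun b hb hb' => hcons b a (hmut _ _ hb hb') (hmut _ _ ha ha') (hmut _ _ hb ha)⟩
    · exact ⟨0, fun a ha ha' => (hex ⟨a, ha, ha'⟩).elim⟩
  refine ⟨C, t, ⟨v, (hC v).2 ⟨.refl v, .refl v⟩, hvW⟩, hs, fun u hu huW => ?_, hW, fun a ha => ?_,
    ht, fun a y ha hy hr => ?_, fun f hf => (hμ f hf).1, fun f hf => (hμ f hf).2, hinj⟩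
  · obtain ⟨p, hp⟩ := ((hC u).1 hu).2
    exact hvW (hWr p v u hp huW)
  · refine or_iff_not_imp_left.2 fun htW => (hC _).2 ?_
    have hrv : D.Reaches (D.tail a) v := (reaches_arc a).trans ((hC _).1 ha).1
    refine ⟨hrv, ?_⟩
    have hsub : (Finset.univ.filter fun u => D.Reaches u (D.tail a)) ⊆
        Finset.univ.filter fun u => D.Reaches u v := fun u hu => by
      simp only [Finset.mem_filter, Finset.mem_univ, true_and] at hu ⊢
      exact hu.trans hrv
    have heq := Finset.eq_of_subset_of_card_le hsub (hmin _ (Finset.mem_compl.2 htW))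
    have hmem : v ∈ Finset.univ.filter fun u => D.Reaches u v := by simp [Reaches.refl]
    rw [← heq] at hmem
    simpa using hmem
  · exact (hC _).2 ⟨hr.trans ((hC _).1 hy).1, ((hC _).1 ha).2.trans (reaches_arc a)⟩

theorem isTPacking_singleton (hroot : ∀ a, D.head a ≠ s) :
    D.IsTPacking τ s {s} fun a => if D.tail a = s then some a else none := by
  have h : ∀ a, D.head a ∉ ({s} : Finset Vt) := fun a ha => hroot a (by simpa using ha)
  exact ⟨by simp, fun a ha => (h a ha).elim, by grind, by grind, by grind,
    fun a _ _ _ _ ha => (h a ha).elim, fun a ha _ => ⟨a, if_pos (by simpa using ha)⟩, by grind,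
    fun _ => ⟨0, fun a _ ha => (h a ha).elim⟩, by grind⟩

theorem exists_isTPacking_univ (hroot : ∀ a, D.head a ≠ s) (hcons : D.Consistent τ)
    (hpre : D.Preflow τ s) : ∃ c, D.IsTPacking τ s Finset.univ c := by
  obtain ⟨μ, hμ, hinj⟩ := hpre.exists_preceding
  have key : ∀ n W c, Wᶜ.card = n → D.IsTPacking τ s W c →
      ∃ c, D.IsTPacking τ s Finset.univ c := by
    intro n
    induction n using Nat.strong_induction_on with
    | _ n ih =>
      intro W c hn hc
      by_cases hW : W = Finset.univ
      · exact ⟨c, hW ▸ hc⟩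
      · obtain ⟨C, t, ⟨v, hvC, hvW⟩, hL⟩ :=
          exists_isLayer hcons hμ hinj hc.root_mem hc.pred hW
        obtain ⟨c', hc'⟩ := hc.exists_union hL
        refine ih _ ?_ (W ∪ C) c' rfl hc'
        rw [← hn]
        refine Finset.card_lt_card (Finset.ssubset_iff_of_subset (fun x hx => ?_) |>.2
          ⟨v, by simpa using hvW, by simp [hvC]⟩)
        simp only [Finset.mem_compl, Finset.mem_union] at hx ⊢
        tauto
  exact key _ {s} _ rfl (isTPacking_singleton hroot)

theorem WalkFrom.rank_le {B : Set At} {g : Vt → ℕ} (hg : ∀ a ∈ B, g (D.tail a) < g (D.head a))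
    {u v : Vt} {p : List At} (hp : D.WalkFrom u p v) (hpB : ∀ a ∈ p, a ∈ B) :
    g u + p.length ≤ g v := by
  induction p generalizing u with
  | nil =>
    cases hp
    simp
  | cons a p ih =>
    obtain ⟨rfl, hp⟩ := hp
    have h1 := ih hp fun b hb => hpB b (List.mem_cons_of_mem a hb)
    have h2 := hg a (hpB a List.mem_cons_self)
    rw [List.length_cons]
    omega

theorem IsTPacking.isTArb (hroot : ∀ a, D.head a ≠ s) (hc : D.IsTPacking τ s Finset.univ c)
    (e : At) : D.IsTArb τ s (Finset.univ.filter fun a => c a = some e) := by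
  refine ⟨⟨?_, fun v hv hvs => ?_⟩, fun v _ p hpB hp => ?_⟩
  · rintro ⟨v, p, hne, hpB, hp⟩
    obtain ⟨g, hg⟩ := hc.rank e
    have := hp.rank_le (g := g) (fun a ha => hg a (by simpa using ha) (Finset.mem_univ _)) hpB
    have := List.length_pos_of_ne_nil hne
    omega
  · obtain ⟨b, hb, rfl⟩ : ∃ b, c b = some e ∧ D.head b = v := by
      simp only [vertsF, Finset.mem_insert, hvs, false_or, Finset.mem_union, Finset.mem_image,
        Finset.mem_filter, Finset.mem_univ, true_and] at hv
      rcases hv with ⟨a, ha, rfl⟩ | hv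
      · obtain ⟨b, hb, hba, -⟩ := hc.parent a e ha hvs
        exact ⟨b, hb, hba⟩
      · exact hv
    refine Finset.card_eq_one.2 ⟨b, ?_⟩
    ext a
    simp only [Finset.mem_filter, Finset.mem_univ, true_and, Finset.mem_singleton]
    refine ⟨fun h => hc.unique a b e h.1 hb (Finset.mem_univ _) h.2, ?_⟩
    rintro rfl
    exact ⟨hb, rfl⟩
  · have key : ∀ (p : List At) (u : Vt), (∀ a ∈ p, c a = some e) → D.WalkFrom u p v →
        Respects τ p := by
      intro p
      induction p with
      | nil => exact fun _ _ _ => List.isChain_nil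
      | cons a p ih =>
        intro u hpc hpw
        have := ih _ (fun b hb => hpc b (List.mem_cons_of_mem a hb)) hpw.2
        cases p with
        | nil => exact List.isChain_singleton _
        | cons b p =>
          have hb := hpc b (by simp)
          have hba := hpw.2.1
          obtain ⟨a', ha', hab, hle⟩ := hc.parent b e hb (hba ▸ hroot a)
          cases hc.unique a' a e ha' (hpc a (by simp)) (Finset.mem_univ _) (hab.trans hba)
          exact List.isChain_cons_cons.2 ⟨hle, this⟩
    exact key p s (fun a ha => by simpa using hpB a ha) hp.1

end Dgraph

/-- In a consistent pre-flow temporal network `N = ((V ∪ {s}, A), τ)` there is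
a packing of `d⁺_D(s)` τ-respecting `s`-arborescences such that each vertex `v ∈ V`
belongs to at least `λ_N(s,v)` of them. -/
theorem packing_consistent_preflow
    {Vt At : Type} [Fintype Vt] [DecidableEq Vt] [Fintype At] [DecidableEq At]
    (D : Dgraph Vt At) (τ : At → ℕ) (s : Vt)
    (hroot : ∀ a : At, D.head a ≠ s)
    (hcons : D.Consistent τ)
    (hpre : D.Preflow τ s) :
    ∃ B : Fin (D.outdeg s) → Finset At,
      (∀ i, D.IsTArb τ s (B i)) ∧
      (∀ i j, i ≠ j → Disjoint (B i) (B j)) ∧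
      ∀ v : Vt, v ≠ s →
        D.lambdaT τ s v ≤
          (Finset.univ.filter (fun i => v ∈ D.vertsF s (B i))).card := by
  obtain ⟨c, hc⟩ := Dgraph.exists_isTPacking_univ hroot hcons hpre
  let R := Finset.univ.filter fun a => D.tail a = s
  let root : Fin (D.outdeg s) → At := fun i => (R.equivFin.symm i).1
  have hinj : Function.Injective root := fun i j hij =>
    R.equivFin.symm.injective (Subtype.ext hij)
  refine ⟨fun i => Finset.univ.filter fun a => c a = some (root i),
    fun i => hc.isTArb hroot (root i), fun i j hij => ?_, fun v hvs => ?_⟩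
  · refine Finset.disjoint_left.2 fun a ha hb => hij (hinj ?_)
    simp only [Finset.mem_filter, Finset.mem_univ, true_and] at ha hb
    exact Option.some.inj (ha.symm.trans hb)
  · obtain ⟨F, hF, hFc⟩ := hc.cover v (Finset.mem_univ v) hvs
    refine hF.trans ((Finset.card_le_card fun e he => ?_).trans
      (Finset.card_image_le (f := root)))
    obtain ⟨a, ha, hav⟩ := hFc e he
    have heR : e ∈ R := Finset.mem_filter.2 ⟨Finset.mem_univ e, (hc.mem a e ha).1⟩
    have hre : root (R.equivFin ⟨e, heR⟩) = e := by simp [root]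
    refine Finset.mem_image.2 ⟨R.equivFin ⟨e, heR⟩, Finset.mem_filter.2 ⟨Finset.mem_univ _, ?_⟩,
      hre⟩
    refine Finset.mem_insert_of_mem (Finset.mem_union_right _ (Finset.mem_image.2 ⟨a, ?_, hav⟩))
    simp [hre, ha]
end

section
/- Let N = (D = (V ∪ {s, t}, A), τ) be a temporal network where D is almost Eulerian and acyclic, and suppose that for every v ∈ V there exists a τ-respecting bijection μ_v from the set of arcs leaving v to the set of arcs entering v (i.e., τ(μ_v(f)) ≤ τ(f) for every arc f leaving v). Then the arc set of D decomposes into d^+_D(s) τ-respecting directed (s,t)-paths such that each vertex v ∈ V belongs to exactly d^-_D(v) of them. -/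
namespace Dgraph

variable {Vt At : Type}

/-- `D.Step u v` : some arc goes from `u` to `v`. -/
def Step (D : Dgraph Vt At) (u v : Vt) : Prop :=
  ∃ a, D.tail a = u ∧ D.head a = v

theorem step_arc (D : Dgraph Vt At) (a : At) : D.Step (D.tail a) (D.head a) :=
  ⟨a, rfl, rfl⟩

theorem exists_walkFrom_of_transGen {D : Dgraph Vt At} {u v : Vt}
    (h : Relation.TransGen D.Step u v) : ∃ p, p ≠ [] ∧ D.WalkFrom u p v := by
  induction h using Relation.TransGen.head_induction_on with
  | single h =>
    obtain ⟨a, rfl, rfl⟩ := h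
    exact ⟨[a], by simp, rfl, rfl⟩
  | head h _ ih =>
    obtain ⟨a, rfl, rfl⟩ := h
    obtain ⟨p, -, hp⟩ := ih
    exact ⟨a :: p, by simp, rfl, hp⟩

theorem Acyclic.not_transGen {D : Dgraph Vt At} (hD : D.Acyclic) (v : Vt) :
    ¬ Relation.TransGen D.Step v v := fun h ↦
  have ⟨p, hp, hw⟩ := exists_walkFrom_of_transGen h
  hD ⟨v, p, hp, fun _ _ ↦ Set.mem_univ _, hw⟩

theorem Acyclic.wellFounded_transGen {D : Dgraph Vt At} [Finite Vt] (hD : D.Acyclic) :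
    WellFounded (Relation.TransGen D.Step) :=
  have : Std.Irrefl (Relation.TransGen D.Step) := ⟨hD.not_transGen⟩
  Finite.wellFounded_of_trans_of_irrefl _

theorem Acyclic.wellFounded_swap_transGen {D : Dgraph Vt At} [Finite Vt] (hD : D.Acyclic) :
    WellFounded (Function.swap (Relation.TransGen D.Step)) :=
  have : Std.Irrefl (Function.swap (Relation.TransGen D.Step)) := ⟨hD.not_transGen⟩
  have : IsTrans Vt (Function.swap (Relation.TransGen D.Step)) := ⟨fun _ _ _ h h' ↦ h'.trans h⟩
  Finite.wellFounded_of_trans_of_irrefl _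

theorem WalkFrom.transGen_head {D : Dgraph Vt At} {u v : Vt} {p : List At}
    (hp : D.WalkFrom u p v) {a : At} (ha : a ∈ p) :
    Relation.TransGen D.Step u (D.head a) := by
  induction p generalizing u with
  | nil => simp at ha
  | cons b p ih =>
    obtain ⟨rfl, hp⟩ := hp
    rcases List.mem_cons.1 ha with rfl | ha
    · exact .single (D.step_arc a)
    · exact .head (D.step_arc b) (ih hp ha)

theorem WalkFrom.isPath {D : Dgraph Vt At} (hD : D.Acyclic) {u v : Vt} {p : List At}
    (hp : D.WalkFrom u p v) : D.IsPath u p v := by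
  refine ⟨hp, ?_⟩
  induction p generalizing u with
  | nil => simp [walkVerts]
  | cons a p ih =>
    refine List.nodup_cons.2 ⟨fun hu ↦ ?_, ih hp.2⟩
    obtain ⟨b, hb, rfl⟩ := List.mem_map.1 hu
    exact hD.not_transGen _ (hp.transGen_head hb)

theorem IsPath.head_injOn {D : Dgraph Vt At} {u v : Vt} {p : List At} (hp : D.IsPath u p v)
    {a b : At} (ha : a ∈ p) (hb : b ∈ p) (hab : D.head a = D.head b) : a = b :=
  List.inj_on_of_nodup_map (List.nodup_cons.1 hp.2).2 ha hb hab

/-- A relation pairing arcs into `v` with later arcs out of `v` at every vertex `v ∉ {s, t}`. -/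
structure IsLinking (D : Dgraph Vt At) (τ : At → ℕ) (s t : Vt) (N : At → At → Prop) : Prop where
  head_eq : ∀ {a b}, N a b → D.head a = D.tail b
  head_ne_source : ∀ {a b}, N a b → D.head a ≠ s
  head_ne_sink : ∀ {a b}, N a b → D.head a ≠ t
  le : ∀ {a b}, N a b → τ a ≤ τ b
  right_unique : ∀ {a b b'}, N a b → N a b' → b = b'
  left_unique : ∀ {a a' b}, N a b → N a' b → a = a'
  exists_next : ∀ a, D.head a ≠ t → ∃ b, N a b
  exists_prev : ∀ b, D.tail b ≠ s → ∃ a, N a b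

theorem exists_isLinking {D : Dgraph Vt At} {τ : At → ℕ} {s t : Vt}
    (hs : ∀ a, D.head a ≠ s) (ht : ∀ a, D.tail a ≠ t)
    (hmu : ∀ v : Vt, v ≠ s → v ≠ t →
      ∃ μ : {a : At // D.tail a = v} → {a : At // D.head a = v},
        Function.Bijective μ ∧ ∀ f, τ (μ f).1 ≤ τ f.1) :
    ∃ N, D.IsLinking τ s t N := by
  choose μ hμ hτ using hmu
  refine ⟨fun a b ↦ ∃ v, ∃ (h₁ : v ≠ s) (h₂ : v ≠ t) (h : D.tail b = v),
    (μ v h₁ h₂ ⟨b, h⟩).1 = a, ?_, ?_, ?_, ?_, ?_, ?_, fun a ha ↦ ?_, fun b hb ↦ ?_⟩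
  · rintro a b ⟨v, h₁, h₂, h, rfl⟩
    exact (μ v h₁ h₂ ⟨b, h⟩).2.trans h.symm
  · exact fun _ ↦ hs _
  · rintro a b ⟨v, h₁, h₂, h, rfl⟩
    rwa [(μ v h₁ h₂ ⟨b, h⟩).2]
  · rintro a b ⟨v, h₁, h₂, h, rfl⟩
    exact hτ v h₁ h₂ ⟨b, h⟩
  · rintro a b b' ⟨v, h₁, h₂, h, rfl⟩ ⟨v', h₁', h₂', h', hb⟩
    have hv : v' = v := by
      rw [← (μ v h₁ h₂ ⟨b, h⟩).2, ← (μ v' h₁' h₂' ⟨b', h'⟩).2, hb]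
    subst hv
    exact (congrArg Subtype.val ((hμ v' h₁ h₂).1 (Subtype.ext hb))).symm
  · rintro a a' b ⟨v, h₁, h₂, rfl, rfl⟩ ⟨v', h₁', h₂', rfl, rfl⟩
    rfl
  · obtain ⟨b, hb⟩ := (hμ _ (hs a) ha).2 ⟨a, rfl⟩
    exact ⟨b, _, hs a, ha, b.2, congrArg Subtype.val hb⟩
  · exact ⟨_, _, hb, ht b, rfl, rfl⟩

namespace IsLinking

variable {D : Dgraph Vt At} {τ : At → ℕ} {s t : Vt} {N : At → At → Prop}

theorem exists_walkFrom [Finite Vt] (hN : D.IsLinking τ s t N) (hD : D.Acyclic) (a : At) :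
    ∃ q, D.WalkFrom (D.tail a) (a :: q) t ∧ Respects τ (a :: q) ∧
      ∀ x, x ∈ a :: q ↔ Relation.ReflTransGen N a x := by
  induction a using (InvImage.wf D.tail hD.wellFounded_swap_transGen).induction with
  | _ a ih =>
  by_cases ha : D.head a = t
  · refine ⟨[], ⟨rfl, ha⟩, List.isChain_singleton _, fun x ↦ ?_⟩
    rw [List.mem_singleton, Relation.ReflTransGen.cases_head_iff, eq_comm]
    refine (or_iff_left ?_).symm
    rintro ⟨b, hab, -⟩
    exact hN.head_ne_sink hab ha
  · obtain ⟨b, hab⟩ := hN.exists_next a ha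
    obtain ⟨q, hw, hr, hq⟩ := ih b (.single ⟨a, rfl, hN.head_eq hab⟩)
    refine ⟨b :: q, ⟨rfl, by rwa [hN.head_eq hab]⟩,
      List.isChain_cons_cons.2 ⟨hN.le hab, hr⟩, fun x ↦ ?_⟩
    rw [List.mem_cons, hq, Relation.ReflTransGen.cases_head_iff (a := a), eq_comm]
    refine or_congr_right ⟨fun h ↦ ⟨b, hab, h⟩, ?_⟩
    rintro ⟨c, hac, hcx⟩
    rwa [hN.right_unique hab hac]

theorem exists_source [Finite Vt] (hN : D.IsLinking τ s t N) (hD : D.Acyclic) (x : At) :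
    ∃ a, D.tail a = s ∧ Relation.ReflTransGen N a x := by
  induction x using (InvImage.wf D.tail hD.wellFounded_transGen).induction with
  | _ x ih =>
  by_cases hx : D.tail x = s
  · exact ⟨x, hx, .refl⟩
  · obtain ⟨y, hyx⟩ := hN.exists_prev x hx
    obtain ⟨a, ha, hay⟩ := ih y (.single ⟨y, rfl, hN.head_eq hyx⟩)
    exact ⟨a, ha, hay.tail hyx⟩

theorem source_unique (hN : D.IsLinking τ s t N) {a b x : At} (ha : D.tail a = s)
    (hb : D.tail b = s) (hax : Relation.ReflTransGen N a x)
    (hbx : Relation.ReflTransGen N b x) : a = b := by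
  have not_linked {y z : At} (hz : D.tail z = s) : ¬ N y z := fun h ↦
    hN.head_ne_source h ((hN.head_eq h).trans hz)
  induction hax with
  | refl =>
    rcases hbx.cases_tail with h | ⟨y, -, h⟩
    · exact h
    · exact absurd h (not_linked ha)
  | tail _ hyx ih =>
    rcases hbx.cases_tail with rfl | ⟨z, hbz, hzx⟩
    · exact absurd hyx (not_linked hb)
    · exact ih (hN.left_unique hyx hzx ▸ hbz)

end IsLinking

end Dgraph

/-- Let `N = ((V ∪ {s,t}, A), τ)` be an almost Eulerian acyclic temporal
network and suppose that every `v ∈ V` admits a τ-respecting bijection from the arcs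
leaving `v` to the arcs entering `v`. Then the arc set of `D` decomposes into `d⁺_D(s)`
τ-respecting `(s,t)`-paths such that each `v ∈ V` belongs to exactly `d⁻_D(v)` of them. -/
theorem decomposition_almost_eulerian
    {Vt At : Type} [Fintype Vt] [DecidableEq Vt] [Fintype At] [DecidableEq At]
    (D : Dgraph Vt At) (τ : At → ℕ) (s t : Vt) (hst : s ≠ t)
    (heul : ∀ v : Vt, v ≠ s → v ≠ t → D.indeg v = D.outdeg v)
    (hs : D.indeg s = 0) (ht : D.outdeg t = 0)
    (hacyc : D.Acyclic)
    (hmu : ∀ v : Vt, v ≠ s → v ≠ t →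
      ∃ μ : {a : At // D.tail a = v} → {a : At // D.head a = v},
        Function.Bijective μ ∧ ∀ f, τ (μ f).1 ≤ τ f.1) :
    ∃ P : Fin (D.outdeg s) → List At,
      (∀ i, D.IsPath s (P i) t ∧ Dgraph.Respects τ (P i)) ∧
      (∀ i j, i ≠ j → ∀ a, a ∈ P i → a ∉ P j) ∧
      (∀ a : At, ∃ i, a ∈ P i) ∧
      ∀ v : Vt, v ≠ s → v ≠ t →
        (Finset.univ.filter (fun i => v ∈ D.walkVerts s (P i))).card = D.indeg v := by
  have hs' (a : At) : D.head a ≠ s := fun h ↦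
    Finset.notMem_empty a (Finset.card_eq_zero.1 hs ▸ Finset.mem_filter.2 ⟨Finset.mem_univ a, h⟩)
  have ht' (a : At) : D.tail a ≠ t := fun h ↦
    Finset.notMem_empty a (Finset.card_eq_zero.1 ht ▸ Finset.mem_filter.2 ⟨Finset.mem_univ a, h⟩)
  obtain ⟨N, hN⟩ := Dgraph.exists_isLinking hs' ht' hmu
  choose q hw hr hq using hN.exists_walkFrom hacyc
  let e := (Finset.univ.filter (fun a => D.tail a = s)).equivFin
  have he (i : Fin (D.outdeg s)) : D.tail (e.symm i).1 = s :=
    (Finset.mem_filter.1 (e.symm i).2).2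
  let P (i : Fin (D.outdeg s)) : List At := (e.symm i).1 :: q (e.symm i).1
  have hP (i) : D.IsPath s (P i) t := by
    simpa only [he i] using (hw (e.symm i).1).isPath hacyc
  have hmem (a : At) : ∃ i, a ∈ P i := by
    obtain ⟨b, hb, hba⟩ := hN.exists_source hacyc a
    refine ⟨e ⟨b, by simpa using hb⟩, ?_⟩
    simpa [P, hq] using (hq b a).2 hba
  have hunique {i j a} (hi : a ∈ P i) (hj : a ∈ P j) : i = j :=
    e.symm.injective <| Subtype.ext <|
      hN.source_unique (he i) (he j) ((hq _ _).1 hi) ((hq _ _).1 hj)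
  refine ⟨P, fun i ↦ ⟨hP i, hr _⟩, fun i j hij a hi hj ↦ hij (hunique hi hj), hmem,
    fun v hvs _ ↦ ?_⟩
  choose f hf using hmem
  refine (Finset.card_nbij f (fun a ha ↦ ?_) (fun a ha b hb hab ↦ ?_) fun i hi ↦ ?_).symm
  · have hav : D.head a = v := by simpa using ha
    simpa [Dgraph.walkVerts, hvs] using ⟨a, hf a, hav⟩
  · have hav : D.head a = v := by simpa using ha
    have hbv : D.head b = v := by simpa using hb
    exact (hP (f a)).head_injOn (hf a) (hab ▸ hf b) (hav.trans hbv.symm)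
  · obtain ⟨a, ha, hav⟩ : ∃ a ∈ P i, D.head a = v := by
      simpa [Dgraph.walkVerts, hvs] using hi
    exact ⟨a, by simpa using hav, hunique (hf a) ha⟩
end
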